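/- arXiv:1209.3326 — 2 statements merged into one kernel-verified Lean document; each statement's English description precedes it below -/
import Mathlib

section
/- Let c > 0. The function r ↦ γ(D̄(−c, r) ∪ D̄(c, r))/(2r) is strictly decreasing on (0, c). Equivalently, if E and F are disjoint closed disks of the same radius r whose centers are at distance 2c, then the ratio γ(E ∪ F)/(γ(E) + γ(F)) is a strictly decreasing function of r ∈ (0, c). -/
open Complex Filter Metric Set Topology Bornology MeasureTheory

noncomputable section

/-- `f` has value `l` at infinity and derivative `w` at infinity (within the set `s`), i.e.
`f(z) → l` and `z (f(z) - l) → w` as `z → ∞` within `s`. -/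
def HasDerivAtInftyOn (f : ℂ → ℂ) (s : Set ℂ) (l w : ℂ) : Prop :=
  Tendsto f (cobounded ℂ ⊓ 𝓟 s) (𝓝 l) ∧
    Tendsto (fun z => z * (f z - l)) (cobounded ℂ ⊓ 𝓟 s) (𝓝 w)

/-- The analytic capacity of a plane set `K`:
`γ(K) = sup { |f′(∞)| : f` holomorphic on `ℂ∞ ∖ K`, `‖f‖ ≤ 1 }`. -/
def analyticCapacity (K : Set ℂ) : ℝ :=
  sSup { r : ℝ | ∃ (f : ℂ → ℂ) (l w : ℂ),
    DifferentiableOn ℂ f Kᶜ ∧ (∀ z ∈ Kᶜ, ‖f z‖ ≤ 1) ∧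
    HasDerivAtInftyOn f Kᶜ l w ∧ r = ‖w‖ }

/-! ### The `q`-Pochhammer product -/

/-- The infinite product `∏ (1 - P^k x)`. -/
def qE (P : ℝ) (x : ℂ) : ℂ := ∏' k : ℕ, (1 - (P : ℂ) ^ k * x)

lemma qE_summable {P : ℝ} (h0 : 0 < P) (h1 : P < 1) (x : ℂ) :
    Summable fun k : ℕ => ‖-((P : ℂ) ^ k * x)‖ := by
  have := (summable_geometric_of_lt_one h0.le h1).mul_right ‖x‖
  simpa [abs_of_pos h0] using this

lemma qE_mult {P : ℝ} (h0 : 0 < P) (h1 : P < 1) (x : ℂ) :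
    Multipliable fun k : ℕ => (1 - (P : ℂ) ^ k * x) := by
  have := multipliable_one_add_of_summable (qE_summable h0 h1 x)
  simpa [sub_eq_add_neg] using this

lemma qE_tendsto {P : ℝ} (h0 : 0 < P) (h1 : P < 1) (x : ℂ) :
    Tendsto (fun N => ∏ k ∈ Finset.range N, (1 - (P : ℂ) ^ k * x)) atTop (𝓝 (qE P x)) :=
  (qE_mult h0 h1 x).hasProd.tendsto_prod_nat

lemma qE_diff {P : ℝ} (h0 : 0 < P) (h1 : P < 1) :
    DifferentiableOn ℂ (qE P) (ball 0 1) := by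
  have h : HasProdLocallyUniformlyOn (fun (k : ℕ) (x : ℂ) => 1 + -((P : ℂ) ^ k * x))
      (fun x => ∏' k : ℕ, (1 + -((P : ℂ) ^ k * x))) (ball 0 1) := by
    refine (summable_geometric_of_lt_one h0.le h1).hasProdLocallyUniformlyOn_nat_one_add
      isOpen_ball (.of_forall fun n x hx => ?_) (fun _ => by fun_prop)
    have hx' : ‖x‖ < 1 := by simpa using hx
    have : 0 < P ^ n := by positivity
    simp only [norm_neg, norm_mul, norm_pow, Complex.norm_real, Real.norm_eq_abs, abs_of_pos h0]
    nlinarith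
  have := h.differentiableOn
    (.of_forall fun _ => by simpa [Finset.prod_fn] using
      DifferentiableOn.finsetProd (fun _ _ => by fun_prop)) isOpen_ball
  have e : qE P = (fun x => ∏' k : ℕ, (1 + -((P : ℂ) ^ k * x))) := by
    funext x; simp [qE, sub_eq_add_neg]
  rw [e]; exact this

lemma qE_ne {P : ℝ} (h0 : 0 < P) (h1 : P < 1) {x : ℂ} (hx : ‖x‖ < 1) : qE P x ≠ 0 := by
  have := tprod_one_add_ne_zero_of_summable (f := fun k : ℕ => -((P : ℂ) ^ k * x)) ?_
    (qE_summable h0 h1 x)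
  · simpa [qE, sub_eq_add_neg] using this
  · intro k hk
    have h2 : (P : ℂ) ^ k * x = 1 := by linear_combination -hk
    have h3 : ‖(P : ℂ) ^ k * x‖ = 1 := by rw [h2]; simp
    simp only [norm_mul, norm_pow, Complex.norm_real, Real.norm_eq_abs, abs_of_pos h0] at h3
    have : P ^ k ≤ 1 := pow_le_one₀ h0.le h1.le
    have : 0 < P ^ k := by positivity
    nlinarith [norm_nonneg x]

lemma qE_rec {P : ℝ} (h0 : 0 < P) (h1 : P < 1) (x : ℂ) :
    qE P x = (1 - x) * qE P (P * x) := by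
  have a := (tendsto_add_atTop_iff_nat 1).2 (qE_tendsto h0 h1 x)
  have b := (qE_tendsto h0 h1 (P * x)).const_mul (1 - x)
  refine tendsto_nhds_unique a (b.congr fun N => ?_)
  rw [Finset.prod_range_succ', pow_zero, one_mul, mul_comm]
  congr 1
  exact Finset.prod_congr rfl fun k _ => by ring

lemma qE_conj {P : ℝ} (h0 : 0 < P) (h1 : P < 1) (x : ℂ) :
    qE P (starRingEnd ℂ x) = starRingEnd ℂ (qE P x) := by
  have a := qE_tendsto h0 h1 (starRingEnd ℂ x)
  have b := (Complex.continuous_conj.tendsto _).comp (qE_tendsto h0 h1 x)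
  refine tendsto_nhds_unique a (b.congr fun N => ?_)
  simp [map_prod]

/-! ### The Ahlfors function of the annulus -/

/-- The nonvanishing factor. -/
def ahlU (ρ : ℝ) (w : ℂ) : ℂ :=
  ρ * w⁻¹ * (qE (ρ ^ 8) (ρ ^ 8 * w ^ 2) * qE (ρ ^ 8) (ρ ^ 8 * (w⁻¹) ^ 2)) /
    (qE (ρ ^ 8) (ρ ^ 4 * w ^ 2) * qE (ρ ^ 8) (ρ ^ 4 * (w⁻¹) ^ 2))

/-- The Ahlfors function of the annulus `ρ < |w| < 1/ρ`. -/
def ahlF (ρ : ℝ) (w : ℂ) : ℂ := (w ^ 2 - 1) * ahlU ρ w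

/-- A slightly larger annulus. -/
def bigA (ρ : ℝ) : Set ℂ := {w | ρ ^ 2 < ‖w‖ ∧ ‖w‖ < (ρ ^ 2)⁻¹}

lemma isOpen_bigA (ρ : ℝ) : IsOpen (bigA ρ) :=
  (isOpen_lt continuous_const continuous_norm).inter (isOpen_lt continuous_norm continuous_const)

lemma bigA_facts {ρ : ℝ} (h0 : 0 < ρ) (h1 : ρ < 1) {w : ℂ} (hw : w ∈ bigA ρ) :
    w ≠ 0 ∧ ‖(ρ : ℂ) ^ 4 * w ^ 2‖ < 1 ∧ ‖(ρ : ℂ) ^ 4 * (w⁻¹) ^ 2‖ < 1 ∧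
    ‖(ρ : ℂ) ^ 8 * w ^ 2‖ < 1 ∧ ‖(ρ : ℂ) ^ 8 * (w⁻¹) ^ 2‖ < 1 := by
  obtain ⟨ha, hb⟩ := hw
  have hp : 0 < ρ ^ 2 := by positivity
  have hw0 : 0 < ‖w‖ := hp.trans ha
  have hp4 : ρ ^ 4 < 1 := pow_lt_one₀ h0.le h1 (by norm_num)
  have k1 : ρ ^ 2 * ‖w‖ < 1 := by
    rw [lt_inv_comm₀ hw0 hp] at hb
    calc ρ ^ 2 * ‖w‖ < ‖w‖⁻¹ * ‖w‖ := by gcongr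
      _ = 1 := inv_mul_cancel₀ hw0.ne'
  have k2 : ρ ^ 2 * ‖w‖⁻¹ < 1 := by
    rw [← div_eq_mul_inv, div_lt_one hw0]; exact ha
  have e1 : ρ ^ 4 * ‖w‖ ^ 2 < 1 := by
    have : ρ ^ 4 * ‖w‖ ^ 2 = (ρ ^ 2 * ‖w‖) ^ 2 := by ring
    rw [this]; exact pow_lt_one₀ (by positivity) k1 (by norm_num)
  have e2 : ρ ^ 4 * (‖w‖⁻¹) ^ 2 < 1 := by
    have : ρ ^ 4 * (‖w‖⁻¹) ^ 2 = (ρ ^ 2 * ‖w‖⁻¹) ^ 2 := by ring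
    rw [this]; exact pow_lt_one₀ (by positivity) k2 (by norm_num)
  have f1 : ρ ^ 8 * ‖w‖ ^ 2 < 1 := by
    have : ρ ^ 8 * ‖w‖ ^ 2 = ρ ^ 4 * (ρ ^ 4 * ‖w‖ ^ 2) := by ring
    rw [this]; have : 0 ≤ ρ ^ 4 * ‖w‖ ^ 2 := by positivity
    nlinarith
  have f2 : ρ ^ 8 * (‖w‖⁻¹) ^ 2 < 1 := by
    have : ρ ^ 8 * (‖w‖⁻¹) ^ 2 = ρ ^ 4 * (ρ ^ 4 * (‖w‖⁻¹) ^ 2) := by ring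
    rw [this]; have : 0 ≤ ρ ^ 4 * (‖w‖⁻¹) ^ 2 := by positivity
    nlinarith
  refine ⟨norm_pos_iff.mp hw0, ?_, ?_, ?_, ?_⟩ <;>
    simpa only [norm_mul, norm_pow, norm_inv, Complex.norm_real, Real.norm_eq_abs, abs_of_pos h0]

lemma ahlU_diff {ρ : ℝ} (h0 : 0 < ρ) (h1 : ρ < 1) : DifferentiableOn ℂ (ahlU ρ) (bigA ρ) := by
  have p0 : 0 < ρ ^ 8 := by positivity
  have p1 : ρ ^ 8 < 1 := pow_lt_one₀ h0.le h1 (by norm_num)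
  have key : ∀ x : ℂ, ‖x‖ < 1 → DifferentiableAt ℂ (qE (ρ ^ 8)) x := fun x hx =>
    (qE_diff p0 p1).differentiableAt (isOpen_ball.mem_nhds (by simpa using hx))
  intro w hw
  obtain ⟨hw0, a, b, c, d⟩ := bigA_facts h0 h1 hw
  apply DifferentiableAt.differentiableWithinAt
  have i : DifferentiableAt ℂ (fun w : ℂ => w⁻¹) w := differentiableAt_inv hw0
  have A := DifferentiableAt.comp w (key _ a) (show DifferentiableAt ℂ (fun w : ℂ => (ρ : ℂ) ^ 4 * w ^ 2) w by fun_prop)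
  have B := DifferentiableAt.comp w (key _ b) (show DifferentiableAt ℂ (fun w : ℂ => (ρ : ℂ) ^ 4 * (w⁻¹) ^ 2) w by fun_prop)
  have C := DifferentiableAt.comp w (key _ c) (show DifferentiableAt ℂ (fun w : ℂ => (ρ : ℂ) ^ 8 * w ^ 2) w by fun_prop)
  have D := DifferentiableAt.comp w (key _ d) (show DifferentiableAt ℂ (fun w : ℂ => (ρ : ℂ) ^ 8 * (w⁻¹) ^ 2) w by fun_prop)
  exact ((i.const_mul (ρ : ℂ)).mul (C.mul D)).div (A.mul B)
    (mul_ne_zero (qE_ne p0 p1 a) (qE_ne p0 p1 b))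

lemma ahlU_ne {ρ : ℝ} (h0 : 0 < ρ) (h1 : ρ < 1) {w : ℂ} (hw : w ∈ bigA ρ) : ahlU ρ w ≠ 0 := by
  have p0 : 0 < ρ ^ 8 := by positivity
  have p1 : ρ ^ 8 < 1 := pow_lt_one₀ h0.le h1 (by norm_num)
  obtain ⟨hw0, a, b, c, d⟩ := bigA_facts h0 h1 hw
  have : (ρ : ℂ) ≠ 0 := by exact_mod_cast h0.ne'
  exact div_ne_zero (mul_ne_zero (mul_ne_zero this (inv_ne_zero hw0))
    (mul_ne_zero (qE_ne p0 p1 c) (qE_ne p0 p1 d)))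
    (mul_ne_zero (qE_ne p0 p1 a) (qE_ne p0 p1 b))

lemma ahlF_inv {ρ : ℝ} {w : ℂ} (hw0 : w ≠ 0) :
    ahlF ρ w⁻¹ = - ahlF ρ w := by
  simp only [ahlF, ahlU, inv_inv]
  rw [mul_comm (qE (ρ ^ 8) (ρ ^ 8 * (w⁻¹) ^ 2)), mul_comm (qE (ρ ^ 8) (ρ ^ 4 * (w⁻¹) ^ 2))]
  rw [mul_div_assoc (ρ * w), mul_div_assoc (ρ * w⁻¹)]
  have : ((w⁻¹) ^ 2 - 1) * w = - ((w ^ 2 - 1) * w⁻¹) := by field_simp; ring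
  generalize qE (ρ ^ 8) (ρ ^ 8 * w ^ 2) * qE (ρ ^ 8) (ρ ^ 8 * (w⁻¹) ^ 2) /
    (qE (ρ ^ 8) (ρ ^ 4 * w ^ 2) * qE (ρ ^ 8) (ρ ^ 4 * (w⁻¹) ^ 2)) = Z
  linear_combination (ρ : ℂ) * Z * this

lemma ahlF_conj {ρ : ℝ} (h0 : 0 < ρ) (h1 : ρ < 1) (w : ℂ) :
    ahlF ρ (starRingEnd ℂ w) = starRingEnd ℂ (ahlF ρ w) := by
  have p0 : 0 < ρ ^ 8 := by positivity
  have p1 : ρ ^ 8 < 1 := pow_lt_one₀ h0.le h1 (by norm_num)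
  simp [ahlF, ahlU, ← qE_conj p0 p1]

lemma ahlF_outer {ρ : ℝ} (h0 : 0 < ρ) (h1 : ρ < 1) {w : ℂ} (hw : ‖w‖ = ρ⁻¹) :
    ‖ahlF ρ w‖ = 1 := by
  have p0 : 0 < ρ ^ 8 := by positivity
  have p1 : ρ ^ 8 < 1 := pow_lt_one₀ h0.le h1 (by norm_num)
  have hρ : (ρ : ℂ) ≠ 0 := by exact_mod_cast h0.ne'
  have hi : 1 < ρ⁻¹ := (one_lt_inv₀ h0).2 h1
  have hwA : w ∈ bigA ρ := by
    refine ⟨?_, ?_⟩ <;> rw [hw]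
    · nlinarith
    · gcongr; nlinarith
  obtain ⟨hw0, a, b, c, d⟩ := bigA_facts h0 h1 hwA
  have hcw : starRingEnd ℂ w = ((ρ : ℂ) ^ 2)⁻¹ * w⁻¹ := by
    rw [eq_mul_inv_iff_mul_eq₀ hw0, mul_comm, Complex.mul_conj, Complex.normSq_eq_norm_sq, hw]
    push_cast; simp
  have hw1 : 1 - (w⁻¹) ^ 2 ≠ 0 := by
    intro h
    have : ‖(w⁻¹) ^ 2‖ = 1 := by rw [← sub_eq_zero.mp h]; simp
    rw [norm_pow, norm_inv, hw, inv_inv] at this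
    nlinarith
  have h41 : 1 - (ρ : ℂ) ^ 4 * w ^ 2 ≠ 0 := by
    intro h; rw [← sub_eq_zero.mp h] at a; simp at a
  have r1 := qE_rec p0 p1 ((ρ : ℂ) ^ 4 * w ^ 2)
  have r2 := qE_rec p0 p1 ((w⁻¹) ^ 2)
  push_cast at r1 r2
  have main : ahlF ρ w * starRingEnd ℂ (ahlF ρ w) = 1 := by
    rw [← ahlF_conj h0 h1, hcw]
    have e1 : (ρ : ℂ) ^ 8 * (((ρ : ℂ) ^ 2)⁻¹ * w⁻¹) ^ 2 = ρ ^ 4 * (w⁻¹) ^ 2 := by field_simp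
    have e2 : (ρ : ℂ) ^ 8 * ((((ρ : ℂ) ^ 2)⁻¹ * w⁻¹)⁻¹) ^ 2 = ρ ^ 8 * (ρ ^ 4 * w ^ 2) := by
      field_simp
    have e3 : (ρ : ℂ) ^ 4 * (((ρ : ℂ) ^ 2)⁻¹ * w⁻¹) ^ 2 = (w⁻¹) ^ 2 := by field_simp
    have e4 : (ρ : ℂ) ^ 4 * ((((ρ : ℂ) ^ 2)⁻¹ * w⁻¹)⁻¹) ^ 2 = ρ ^ 8 * w ^ 2 := by
      field_simp
    simp only [ahlF, ahlU]
    rw [e1, e2, e3, e4, r2, r1]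
    have n1 := qE_ne p0 p1 b
    have n2 := qE_ne p0 p1 c
    have n3 := qE_ne p0 p1 d
    have n4 := qE_ne p0 p1 a
    rw [r1] at n4
    have n5 := right_ne_zero_of_mul n4
    generalize qE (ρ ^ 8) ((ρ : ℂ) ^ 8 * w ^ 2) = X1 at *
    generalize qE (ρ ^ 8) ((ρ : ℂ) ^ 8 * (w⁻¹) ^ 2) = X2 at *
    generalize qE (ρ ^ 8) ((ρ : ℂ) ^ 4 * (w⁻¹) ^ 2) = X3 at *
    generalize qE (ρ ^ 8) ((ρ : ℂ) ^ 8 * ((ρ : ℂ) ^ 4 * w ^ 2)) = X4 at *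
    have hw2 : w ^ 2 - 1 ≠ 0 := by
      intro h; apply hw1; field_simp; simpa using h
    have hw1' : 1 - (w⁻¹) ^ 2 = (w ^ 2 - 1) / w ^ 2 := by field_simp
    rw [hw1']
    have hY : ((((ρ : ℂ) ^ 2)⁻¹ * w⁻¹) ^ 2 - 1) = (1 - (ρ : ℂ) ^ 4 * w ^ 2) / (ρ ^ 4 * w ^ 2) := by
      field_simp
    rw [hY]
    generalize 1 - (ρ : ℂ) ^ 4 * w ^ 2 = Y at *
    field_simp
  have h2 : ‖ahlF ρ w‖ * ‖ahlF ρ w‖ = 1 := by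
    have := congrArg norm main
    simpa using this
  nlinarith [norm_nonneg (ahlF ρ w)]

lemma ahlF_inner {ρ : ℝ} (h0 : 0 < ρ) (h1 : ρ < 1) {w : ℂ} (hw : ‖w‖ = ρ) :
    ‖ahlF ρ w‖ = 1 := by
  have hw0 : w ≠ 0 := by rw [← norm_pos_iff, hw]; exact h0
  have := ahlF_outer h0 h1 (w := w⁻¹) (by rw [norm_inv, hw])
  rwa [ahlF_inv hw0, norm_neg] at this

/-- The annulus. -/
def annA (ρ : ℝ) : Set ℂ := {w | ρ < ‖w‖ ∧ ‖w‖ < ρ⁻¹}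

lemma isOpen_annA (ρ : ℝ) : IsOpen (annA ρ) :=
  (isOpen_lt continuous_const continuous_norm).inter (isOpen_lt continuous_norm continuous_const)

lemma annA_inv {ρ : ℝ} (h0 : 0 < ρ) {w : ℂ} (hw : w ∈ annA ρ) : w⁻¹ ∈ annA ρ := by
  obtain ⟨a, b⟩ := hw
  have hw0 : 0 < ‖w‖ := h0.trans a
  refine ⟨?_, ?_⟩ <;> rw [norm_inv]
  · rwa [lt_inv_comm₀ h0 hw0]
  · rwa [inv_lt_inv₀ hw0 h0]

lemma annA_sub_bigA {ρ : ℝ} (h0 : 0 < ρ) (h1 : ρ < 1) : annA ρ ⊆ bigA ρ := by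
  rintro w ⟨a, b⟩
  have : ρ ^ 2 < ρ := by nlinarith
  exact ⟨this.trans a, b.trans (by gcongr)⟩

lemma one_mem_annA {ρ : ℝ} (h0 : 0 < ρ) (h1 : ρ < 1) : (1 : ℂ) ∈ annA ρ :=
  ⟨by simpa using h1, by simpa using (one_lt_inv₀ h0).2 h1⟩

lemma neg_one_mem_annA {ρ : ℝ} (h0 : 0 < ρ) (h1 : ρ < 1) : (-1 : ℂ) ∈ annA ρ :=
  ⟨by simpa using h1, by simpa using (one_lt_inv₀ h0).2 h1⟩

lemma ann_max {ρ : ℝ} (h0 : 0 < ρ) {h : ℂ → ℂ} (hd : DifferentiableOn ℂ h (annA ρ))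
    (hb : ∀ C : ℝ, 1 < C → ∃ s0, ρ < s0 ∧ ∀ w ∈ annA ρ, (‖w‖ ≤ s0 ∨ s0⁻¹ ≤ ‖w‖) → ‖h w‖ ≤ C)
    {w : ℂ} (hw : w ∈ annA ρ) : ‖h w‖ ≤ 1 := by
  refine le_of_forall_gt_imp_ge_of_dense fun C hC => ?_
  obtain ⟨s0, hs0, hs⟩ := hb C hC
  have hw0 : 0 < ‖w‖ := h0.trans hw.1
  have hwi : ρ < ‖w‖⁻¹ := by have := (annA_inv h0 hw).1; rwa [norm_inv] at this
  obtain ⟨s, hρs, hs'⟩ := exists_between (lt_min hs0 (lt_min hw.1 hwi))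
  have a1 : s < s0 := hs'.trans_le (min_le_left _ _)
  have a2 : s < ‖w‖ := hs'.trans_le ((min_le_right _ _).trans (min_le_left _ _))
  have a3 : s < ‖w‖⁻¹ := hs'.trans_le ((min_le_right _ _).trans (min_le_right _ _))
  have sp : 0 < s := h0.trans hρs
  have s0p : 0 < s0 := h0.trans hs0
  set U : Set ℂ := {z | s < ‖z‖ ∧ ‖z‖ < s⁻¹} with hU
  have hUo : IsOpen U := isOpen_annA s
  have hcl : closure U ⊆ {z | s ≤ ‖z‖ ∧ ‖z‖ ≤ s⁻¹} := by
    apply closure_minimal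
    · exact fun z hz => ⟨hz.1.le, hz.2.le⟩
    · exact (isClosed_le continuous_const continuous_norm).inter
        (isClosed_le continuous_norm continuous_const)
  have hinv : s⁻¹ < ρ⁻¹ := by gcongr
  have hclA : closure U ⊆ annA ρ := fun z hz =>
    ⟨hρs.trans_le (hcl hz).1, (hcl hz).2.trans_lt hinv⟩
  have hbd : IsBounded U := by
    refine (isBounded_closedBall (x := (0:ℂ)) (r := s⁻¹)).subset fun z hz => ?_
    simpa using hz.2.le
  refine norm_le_of_forall_mem_frontier_norm_le hbd (hd.mono hclA).diffContOnCl (fun z hz => ?_)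
    (subset_closure (show w ∈ U from ⟨a2, by rwa [lt_inv_comm₀ hw0 sp]⟩))
  have hzc := hz.1
  have hzU : z ∉ U := by rw [hUo.frontier_eq] at hz; exact hz.2
  apply hs z (hclA hzc)
  obtain ⟨b1, b2⟩ := hcl hzc
  by_contra! hcon
  apply hzU
  refine ⟨a1.trans hcon.1, hcon.2.trans ?_⟩
  gcongr

lemma ahlF_near_inner {ρ : ℝ} (h0 : 0 < ρ) (h1 : ρ < 1) {δ : ℝ} (hδ : 0 < δ) :
    ∃ s0, ρ < s0 ∧ ∀ w ∈ annA ρ, ‖w‖ ≤ s0 → |‖ahlF ρ w‖ - 1| ≤ δ := by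
  have hi : 1 < ρ⁻¹ := (one_lt_inv₀ h0).2 h1
  set K : Set ℂ := {z | ρ ≤ ‖z‖ ∧ ‖z‖ ≤ ρ⁻¹} with hK
  have hKc : IsCompact K := by
    apply Metric.isCompact_of_isClosed_isBounded
    · exact (isClosed_le continuous_const continuous_norm).inter
        (isClosed_le continuous_norm continuous_const)
    · refine (isBounded_closedBall (x := (0:ℂ)) (r := ρ⁻¹)).subset fun z hz => ?_
      simpa using hz.2
  have hKb : K ⊆ bigA ρ := by
    rintro w ⟨a, b⟩
    have : ρ ^ 2 < ρ := by nlinarith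
    exact ⟨this.trans_le a, b.trans_lt (by gcongr)⟩
  have hc : ContinuousOn (ahlF ρ) K := by
    have := ((ahlU_diff h0 h1).continuousOn).mono hKb
    exact ContinuousOn.mul (by fun_prop) this
  have hu := hKc.uniformContinuousOn_of_continuous hc
  rw [Metric.uniformContinuousOn_iff] at hu
  obtain ⟨η, hη, hu⟩ := hu δ hδ
  refine ⟨ρ + η / 2, by linarith, fun w hw hws => ?_⟩
  have hwp : 0 < ‖w‖ := h0.trans hw.1
  set w' : ℂ := (ρ / ‖w‖ : ℝ) * w with hw'
  have hnw' : ‖w'‖ = ρ := by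
    rw [hw', norm_mul, Complex.norm_real, Real.norm_eq_abs, abs_of_pos (by positivity)]
    field_simp
  have hd : dist w w' < η := by
    have : w - w' = ((1 - ρ / ‖w‖ : ℝ) : ℂ) * w := by rw [hw']; push_cast; ring
    rw [dist_eq_norm, this, norm_mul, Complex.norm_real, Real.norm_eq_abs, abs_of_nonneg]
    · have : (1 - ρ / ‖w‖) * ‖w‖ = ‖w‖ - ρ := by field_simp
      rw [this]; linarith
    · rw [sub_nonneg, div_le_one hwp]; exact hw.1.le
  have := hu w ⟨hw.1.le, hw.2.le⟩ w' ⟨hnw'.ge, by rw [hnw']; linarith⟩ hd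
  rw [dist_eq_norm] at this
  have h2 := abs_norm_sub_norm_le (ahlF ρ w) (ahlF ρ w')
  rw [ahlF_inner h0 h1 hnw'] at h2
  exact h2.trans this.le

lemma ahlF_near {ρ : ℝ} (h0 : 0 < ρ) (h1 : ρ < 1) {δ : ℝ} (hδ : 0 < δ) :
    ∃ s0, ρ < s0 ∧ ∀ w ∈ annA ρ, (‖w‖ ≤ s0 ∨ s0⁻¹ ≤ ‖w‖) → |‖ahlF ρ w‖ - 1| ≤ δ := by
  obtain ⟨s0, hs0, h⟩ := ahlF_near_inner h0 h1 hδ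
  refine ⟨s0, hs0, fun w hw hor => ?_⟩
  rcases hor with h' | h'
  · exact h w hw h'
  · have hw0 : 0 < ‖w‖ := h0.trans hw.1
    have := h w⁻¹ (annA_inv h0 hw) (by rw [norm_inv]; exact inv_le_of_inv_le₀ (h0.trans hs0) h')
    rwa [ahlF_inv (norm_pos_iff.mp hw0), norm_neg] at this

lemma ahlF_diff {ρ : ℝ} (h0 : 0 < ρ) (h1 : ρ < 1) : DifferentiableOn ℂ (ahlF ρ) (annA ρ) :=
  DifferentiableOn.mul (by fun_prop) ((ahlU_diff h0 h1).mono (annA_sub_bigA h0 h1))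

lemma ahlF_le {ρ : ℝ} (h0 : 0 < ρ) (h1 : ρ < 1) {w : ℂ} (hw : w ∈ annA ρ) :
    ‖ahlF ρ w‖ ≤ 1 := by
  refine ann_max h0 (ahlF_diff h0 h1) (fun C hC => ?_) hw
  obtain ⟨s0, hs0, h⟩ := ahlF_near h0 h1 (δ := C - 1) (by linarith)
  refine ⟨s0, hs0, fun w hw ho => ?_⟩
  have := (abs_le.mp (h w hw ho)).2
  linarith

lemma ahlF_hasDeriv {ρ : ℝ} (h0 : 0 < ρ) (h1 : ρ < 1) :
    HasDerivAt (ahlF ρ) (2 * ahlU ρ 1) 1 := by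
  have hU : DifferentiableAt ℂ (ahlU ρ) 1 := (ahlU_diff h0 h1).differentiableAt
    ((isOpen_bigA ρ).mem_nhds (annA_sub_bigA h0 h1 (one_mem_annA h0 h1)))
  have h := (((hasDerivAt_id (1:ℂ)).pow 2).sub_const 1).mul hU.hasDerivAt
  refine h.congr_deriv ?_
  norm_num

lemma ann_upper {ρ : ℝ} (h0 : 0 < ρ) (h1 : ρ < 1) {G : ℂ → ℂ} {d : ℂ}
    (hG : DifferentiableOn ℂ G (annA ρ))
    (hb : ∀ w ∈ annA ρ, ‖G w‖ ≤ 1) (hd : HasDerivAt G d 1) : ‖d‖ ≤ 2 * ‖ahlU ρ 1‖ := by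
  have hA : annA ρ ∈ 𝓝 (1 : ℂ) := (isOpen_annA ρ).mem_nhds (one_mem_annA h0 h1)
  have hA' : annA ρ ∈ 𝓝 (-1 : ℂ) := (isOpen_annA ρ).mem_nhds (neg_one_mem_annA h0 h1)
  have hne : ∀ w ∈ annA ρ, w ≠ 0 := fun w hw => norm_pos_iff.mp (h0.trans hw.1)
  set Gt : ℂ → ℂ := fun w => (G w - G w⁻¹) / 2 with hGt
  have hGtd : DifferentiableOn ℂ Gt (annA ρ) := by
    refine (hG.sub (hG.comp ?_ fun w hw => annA_inv h0 hw)).div_const 2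
    exact fun w hw => (differentiableAt_inv (hne w hw)).differentiableWithinAt
  have hGt1 : Gt 1 = 0 := by simp [hGt]
  have hGtm1 : Gt (-1) = 0 := by simp [hGt, inv_neg]
  have hGtb : ∀ w ∈ annA ρ, ‖Gt w‖ ≤ 1 := fun w hw => by
    have a := hb w hw
    have b := hb _ (annA_inv h0 hw)
    have := norm_sub_le (G w) (G w⁻¹)
    simp only [hGt, norm_div, Complex.norm_ofNat]
    linarith
  have hGt' : HasDerivAt Gt d 1 := by
    have hi : HasDerivAt (fun w : ℂ => w⁻¹) (-1) 1 := by
      simpa using hasDerivAt_inv (one_ne_zero (α := ℂ))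
    have hd' : HasDerivAt G d ((1:ℂ)⁻¹) := by simpa using hd
    have hc : HasDerivAt (fun w : ℂ => G w⁻¹) (d * (-1)) 1 := HasDerivAt.comp (1:ℂ) hd' hi
    refine ((hd.sub hc).div_const 2).congr_deriv ?_
    ring
  set G1 := dslope Gt 1 with hG1
  have hG1d : DifferentiableOn ℂ G1 (annA ρ) := (differentiableOn_dslope hA).2 hGtd
  have e1 : ∀ w, (w - 1) * G1 w = Gt w := fun w => by
    have := sub_smul_dslope Gt 1 w
    rw [hGt1] at this; simpa using this
  have hG1m : G1 (-1) = 0 := by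
    have := e1 (-1); rw [hGtm1] at this
    rcases mul_eq_zero.mp this with h | h
    · norm_num at h
    · exact h
  set G2 := dslope G1 (-1) with hG2
  have hG2d : DifferentiableOn ℂ G2 (annA ρ) := (differentiableOn_dslope hA').2 hG1d
  have e2 : ∀ w, (w + 1) * G2 w = G1 w := fun w => by
    have := sub_smul_dslope G1 (-1) w
    rw [hG1m] at this; simpa using this
  have hG11 : G1 1 = d := by rw [hG1, dslope_same, hGt'.deriv]
  have hUne : ∀ w ∈ annA ρ, ahlU ρ w ≠ 0 := fun w hw => ahlU_ne h0 h1 (annA_sub_bigA h0 h1 hw)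
  have hHd : DifferentiableOn ℂ (fun w => G2 w / ahlU ρ w) (annA ρ) :=
    hG2d.div ((ahlU_diff h0 h1).mono (annA_sub_bigA h0 h1)) hUne
  have hH : ‖G2 1 / ahlU ρ 1‖ ≤ 1 := by
    refine ann_max h0 hHd (fun C hC => ?_) (one_mem_annA h0 h1)
    have hCi : C⁻¹ < 1 := inv_lt_one_of_one_lt₀ hC
    obtain ⟨s0, hs0, h⟩ := ahlF_near h0 h1 (δ := 1 - C⁻¹) (by linarith)
    refine ⟨s0, hs0, fun w hw ho => ?_⟩
    have k1 := (abs_le.mp (h w hw ho)).1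
    have k2 : C⁻¹ ≤ ‖ahlF ρ w‖ := by linarith
    have k3 : G2 w / ahlU ρ w * ahlF ρ w = Gt w := by
      rw [← e1, ← e2, ahlF]
      have := hUne w hw
      field_simp
      ring
    have k4 : ‖G2 w / ahlU ρ w‖ * ‖ahlF ρ w‖ ≤ 1 := by
      rw [← norm_mul, k3]; exact hGtb w hw
    have k5 : ‖G2 w / ahlU ρ w‖ * C⁻¹ ≤ 1 :=
      (mul_le_mul_of_nonneg_left k2 (norm_nonneg _)).trans k4
    rwa [← div_eq_mul_inv, div_le_one (by linarith)] at k5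
  have hU1 := norm_pos_iff.2 (hUne 1 (one_mem_annA h0 h1))
  rw [norm_div, div_le_one hU1] at hH
  rw [← hG11, ← e2, norm_mul]
  norm_num
  linarith

/-! ### Transport to the two disks -/

lemma disk_key {ρ c r a : ℝ} (h0 : 0 < ρ) (h1 : ρ < 1) (hc : 0 < c)
    (hr : r = 2 * c * ρ / (1 + ρ ^ 2)) (ha : a = c * (1 - ρ ^ 2) / (1 + ρ ^ 2)) (z : ℂ) :
    ρ * ‖z + a‖ < ‖z - a‖ ↔ r < ‖z - c‖ := by
  have hp : 0 < 1 + ρ ^ 2 := by positivity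
  have hr0 : 0 ≤ r := by rw [hr]; positivity
  have e : ‖z - a‖ ^ 2 - ρ ^ 2 * ‖z + a‖ ^ 2 = (1 - ρ ^ 2) * (‖z - c‖ ^ 2 - r ^ 2) := by
    simp only [← Complex.normSq_eq_norm_sq, Complex.normSq_apply, sub_re, add_re, sub_im, add_im,
      ofReal_re, ofReal_im]
    rw [hr, ha]
    field_simp
    ring
  have hq : 0 < 1 - ρ ^ 2 := by nlinarith
  have n1 := norm_nonneg (z - a)
  have n2 := norm_nonneg (z + a)
  have n3 := norm_nonneg (z - c)
  rw [← pow_lt_pow_iff_left₀ (by positivity) n1 two_ne_zero,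
    ← pow_lt_pow_iff_left₀ hr0 n3 two_ne_zero, mul_pow]
  constructor
  · intro h
    have : 0 < (1 - ρ ^ 2) * (‖z - c‖ ^ 2 - r ^ 2) := by linarith
    have := pos_of_mul_pos_right this hq.le
    linarith
  · intro h
    have : 0 < (1 - ρ ^ 2) * (‖z - c‖ ^ 2 - r ^ 2) := mul_pos hq (by linarith)
    linarith

lemma disk_compl {ρ c r a : ℝ} (h0 : 0 < ρ) (h1 : ρ < 1) (hc : 0 < c)
    (hr : r = 2 * c * ρ / (1 + ρ ^ 2)) (ha : a = c * (1 - ρ ^ 2) / (1 + ρ ^ 2)) (z : ℂ) :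
    z ∈ (closedBall (-(c:ℂ)) r ∪ closedBall (c:ℂ) r)ᶜ ↔
      ρ * ‖z + a‖ < ‖z - a‖ ∧ ρ * ‖z - a‖ < ‖z + a‖ := by
  have k1 := disk_key h0 h1 hc hr ha z
  have k2 := disk_key h0 h1 hc hr ha (-z)
  have e1 : ‖-z + a‖ = ‖z - a‖ := by rw [← norm_neg]; congr 1; ring
  have e2 : ‖-z - a‖ = ‖z + a‖ := by rw [← norm_neg]; congr 1; ring
  have e3 : ‖-z - c‖ = ‖z + c‖ := by rw [← norm_neg]; congr 1; ring
  rw [e1, e2, e3] at k2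
  rw [k1, k2]
  simp [dist_eq_norm, and_comm]

lemma cap_eq {ρ c r a : ℝ} (h0 : 0 < ρ) (h1 : ρ < 1) (hc : 0 < c)
    (hr : r = 2 * c * ρ / (1 + ρ ^ 2)) (ha : a = c * (1 - ρ ^ 2) / (1 + ρ ^ 2)) :
    analyticCapacity (closedBall (-(c:ℂ)) r ∪ closedBall (c:ℂ) r) = 4 * a * ‖ahlU ρ 1‖ := by
  have hq : 0 < 1 - ρ ^ 2 := by nlinarith
  have hap : 0 < a := by rw [ha]; positivity
  have haC : (a : ℂ) ≠ 0 := by exact_mod_cast hap.ne'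
  set K : Set ℂ := closedBall (-(c:ℂ)) r ∪ closedBall (c:ℂ) r with hK
  have hKm : ∀ z, z ∈ Kᶜ ↔ ρ * ‖z + a‖ < ‖z - a‖ ∧ ρ * ‖z - a‖ < ‖z + a‖ :=
    disk_compl h0 h1 hc hr ha
  have hKo : IsOpen Kᶜ := (isClosed_closedBall.union isClosed_closedBall).isOpen_compl
  have hKne : ∀ z ∈ Kᶜ, z + a ≠ 0 := fun z hz h => by
    have := ((hKm z).1 hz).2
    rw [h, norm_zero] at this
    nlinarith [norm_nonneg (z - a)]
  have hKann : ∀ z ∈ Kᶜ, (z - a) / (z + a) ∈ annA ρ := fun z hz => by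
    have hp := norm_pos_iff.2 (hKne z hz)
    obtain ⟨k1, k2⟩ := (hKm z).1 hz
    refine ⟨?_, ?_⟩ <;> rw [norm_div]
    · rwa [lt_div_iff₀ hp]
    · rw [div_lt_iff₀ hp, inv_mul_eq_div, lt_div_iff₀ h0, mul_comm]; exact k2
  have hann : ∀ w ∈ annA ρ, w ≠ 1 → (a : ℂ) * (1 + w) / (1 - w) ∈ Kᶜ := fun w hw hw1 => by
    have hne : 1 - w ≠ 0 := sub_ne_zero.2 hw1.symm
    rw [hKm]
    have e1 : (a : ℂ) * (1 + w) / (1 - w) + a = 2 * a / (1 - w) := by field_simp; ring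
    have e2 : (a : ℂ) * (1 + w) / (1 - w) - a = w * (2 * a / (1 - w)) := by field_simp; ring
    rw [e1, e2, norm_mul]
    have hp : 0 < ‖(2 * a / (1 - w) : ℂ)‖ := by
      rw [norm_pos_iff]; exact div_ne_zero (mul_ne_zero two_ne_zero haC) hne
    have hi := (lt_inv_comm₀ (h0.trans hw.1) h0).1 hw.2
    have hw2 : ρ * ‖w‖ < 1 := by
      have := hw.2
      rwa [← one_div, lt_div_iff₀ h0, mul_comm] at this
    constructor
    · have := hw.1
      gcongr
    · nlinarith
  have hA : annA ρ ∈ 𝓝 (1 : ℂ) := (isOpen_annA ρ).mem_nhds (one_mem_annA h0 h1)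
  apply IsGreatest.csSup_eq
  constructor
  · refine ⟨fun z => ahlF ρ ((z - a) / (z + a)), 0, -2 * a * (2 * ahlU ρ 1), ?_, ?_, ⟨?_, ?_⟩, ?_⟩
    · refine (ahlF_diff h0 h1).comp ?_ hKann
      exact DifferentiableOn.div (by fun_prop) (by fun_prop) hKne
    · exact fun z hz => ahlF_le h0 h1 (hKann z hz)
    all_goals
      have t0 : Tendsto (fun z : ℂ => (z + a)⁻¹) (cobounded ℂ ⊓ 𝓟 Kᶜ) (𝓝 0) := by
        refine (tendsto_inv₀_cobounded.comp ?_).mono_left inf_le_left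
        exact tendsto_add_const_cobounded _
      have ev : ∀ᶠ z in cobounded ℂ ⊓ 𝓟 Kᶜ, z ∈ Kᶜ := mem_inf_of_right (mem_principal_self _)
      have t1 : Tendsto (fun z : ℂ => (z - a) / (z + a)) (cobounded ℂ ⊓ 𝓟 Kᶜ) (𝓝 1) := by
        have := (t0.const_mul (-2 * (a : ℂ))).const_add 1
        simp only [mul_zero, add_zero] at this
        refine this.congr' (ev.mono fun z hz => ?_)
        have := hKne z hz
        field_simp
        ring
      have F1 : ahlF ρ 1 = 0 := by simp [ahlF]
    · have := (ahlF_hasDeriv h0 h1).continuousAt.tendsto.comp t1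
      rwa [F1] at this
    · have t1' : Tendsto (fun z : ℂ => (z - a) / (z + a)) (cobounded ℂ ⊓ 𝓟 Kᶜ) (𝓝[≠] 1) := by
        refine tendsto_nhdsWithin_iff.2 ⟨t1, ev.mono fun z hz => ?_⟩
        have := hKne z hz
        simp only [mem_compl_iff, mem_singleton_iff]
        rw [div_eq_one_iff_eq this]
        intro h
        apply haC
        linear_combination -h / 2
      have s1 := (hasDerivAt_iff_tendsto_slope.1 (ahlF_hasDeriv h0 h1)).comp t1'
      have s2 : Tendsto (fun z : ℂ => (-2 * a : ℂ) + 2 * a ^ 2 * (z + a)⁻¹) (cobounded ℂ ⊓ 𝓟 Kᶜ)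
          (𝓝 (-2 * a : ℂ)) := by
        have := (t0.const_mul (2 * (a : ℂ) ^ 2)).const_add (-2 * (a : ℂ))
        simpa only [mul_zero, add_zero] using this
      refine (s2.mul s1).congr' (ev.mono fun z hz => ?_)
      have hne := hKne z hz
      simp only [Function.comp, slope_def_field, F1]
      have : (z - a) / (z + a) - 1 = -2 * a / (z + a) := by field_simp; ring
      rw [this]
      field_simp
      ring
    · simp [abs_of_pos hap]; ring
  · rintro x ⟨f, l, w', hf, hfb, ⟨t1, t2⟩, rfl⟩
    set Z : ℂ → ℂ := fun w => (a : ℂ) * (1 + w) / (1 - w) with hZ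
    have tZ : Tendsto Z (𝓝[≠] 1) (cobounded ℂ ⊓ 𝓟 Kᶜ) := by
      refine tendsto_inf.2 ⟨?_, tendsto_principal.2 ?_⟩
      · have i1 : Tendsto (fun w : ℂ => (1 - w)⁻¹) (𝓝[≠] 1) (cobounded ℂ) := by
          refine tendsto_inv₀_nhdsNE_zero.comp ?_
          refine tendsto_nhdsWithin_iff.2 ⟨?_, ?_⟩
          · have : Tendsto (fun w : ℂ => 1 - w) (𝓝 1) (𝓝 (1 - 1)) :=
              (continuous_const.sub continuous_id).tendsto 1
            rw [sub_self] at this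
            exact this.mono_left nhdsWithin_le_nhds
          · filter_upwards [self_mem_nhdsWithin] with w hw
            exact sub_ne_zero.2 (Ne.symm hw)
        have i2 : Tendsto (fun w : ℂ => (2 * a : ℂ) * (1 - w)⁻¹ + (-a)) (𝓝[≠] 1) (cobounded ℂ) :=
          (tendsto_add_const_cobounded _).comp
            ((tendsto_mul_left_cobounded (mul_ne_zero two_ne_zero haC)).comp i1)
        refine i2.congr' ?_
        filter_upwards [self_mem_nhdsWithin] with w hw
        have : 1 - w ≠ 0 := sub_ne_zero.2 (Ne.symm hw)
        simp only [hZ]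
        field_simp
        ring
      · filter_upwards [self_mem_nhdsWithin, mem_nhdsWithin_of_mem_nhds hA] with w hw hwA
        exact hann w hwA hw
    have hl : ‖l‖ ≤ 1 := by
      have := (t1.comp tZ).norm
      refine le_of_tendsto this ?_
      filter_upwards [self_mem_nhdsWithin, mem_nhdsWithin_of_mem_nhds hA] with w hw hwA
      exact hfb _ (hann w hwA hw)
    set G : ℂ → ℂ := fun w => if w = 1 then l else f (Z w) with hG
    have G1 : G 1 = l := by simp [hG]
    have Gn : ∀ w, w ≠ 1 → G w = f (Z w) := fun w hw => by simp [hG, hw]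
    have hGd : HasDerivAt G (-(w' + a * 0) / (2 * a)) 1 := by
      rw [hasDerivAt_iff_tendsto_slope]
      have s0 : Tendsto (fun w => f (Z w) - l) (𝓝[≠] 1) (𝓝 0) := by
        have := (t1.comp tZ).sub_const l
        rwa [sub_self] at this
      have s1 := t2.comp tZ
      refine (((s1.add (s0.const_mul (a : ℂ))).neg).div_const (2 * (a : ℂ))).congr' ?_
      filter_upwards [self_mem_nhdsWithin] with w hw
      have h1w : 1 - w ≠ 0 := sub_ne_zero.2 (Ne.symm hw)
      have h2w : w - 1 ≠ 0 := sub_ne_zero.2 hw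
      simp only [Function.comp, slope_def_field, G1, Gn w hw]
      generalize f (Z w) - l = X
      simp only [hZ]
      have : w - 1 = -(1 - w) := by ring
      rw [this]
      field_simp
      ring
    have hGdiff : DifferentiableOn ℂ G (annA ρ) := by
      intro w hw
      apply DifferentiableAt.differentiableWithinAt
      by_cases hw1 : w = 1
      · rw [hw1]; exact hGd.differentiableAt
      · have h1w : 1 - w ≠ 0 := sub_ne_zero.2 (Ne.symm hw1)
        have d1 : DifferentiableAt ℂ f (Z w) := hf.differentiableAt (hKo.mem_nhds (hann w hw hw1))
        have d2 : DifferentiableAt ℂ Z w := DifferentiableAt.div (by fun_prop) (by fun_prop) h1w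
        refine (d1.comp w d2).congr_of_eventuallyEq ?_
        filter_upwards [isOpen_ne.mem_nhds hw1] with v hv
        exact Gn v hv
    have hGb : ∀ w ∈ annA ρ, ‖G w‖ ≤ 1 := fun w hw => by
      by_cases hw1 : w = 1
      · rw [hw1, G1]; exact hl
      · rw [Gn w hw1]; exact hfb _ (hann w hw hw1)
    have fin := ann_upper h0 h1 hGdiff hGb hGd
    have e : ‖-(w' + a * 0) / (2 * a : ℂ)‖ = ‖w'‖ / (2 * a) := by
      simp [abs_of_pos hap]
    rw [e, div_le_iff₀ (by positivity)] at fin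
    linarith

/-! ### Monotonicity of the explicit product -/

lemma xcosh_gt {x : ℝ} (hx : 0 < x) : Real.sinh x < x * Real.cosh x := by
  have h : StrictMonoOn (fun x : ℝ => x * Real.cosh x - Real.sinh x) (Ici 0) := by
    have hd : ∀ x : ℝ, HasDerivAt (fun x : ℝ => x * Real.cosh x - Real.sinh x)
        (x * Real.sinh x) x := fun x => by
      refine (((hasDerivAt_id x).mul (Real.hasDerivAt_cosh x)).sub
        (Real.hasDerivAt_sinh x)).congr_deriv ?_
      simp
    refine strictMonoOn_of_deriv_pos (convex_Ici 0) (by fun_prop) fun y hy => ?_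
    rw [interior_Ici, mem_Ioi] at hy
    rw [(hd y).deriv]
    exact mul_pos hy (Real.sinh_pos_iff.2 hy)
  have := h (mem_Ici.2 le_rfl) (mem_Ici.2 hx.le) hx
  simp at this
  linarith

lemma cusa {x : ℝ} (hx : 0 < x) : 3 * Real.sinh x < x * (2 + Real.cosh x) := by
  have h1 : ∀ x : ℝ, 0 < x → 0 < 2 - 2 * Real.cosh x + x * Real.sinh x := by
    intro x hx
    have h : StrictMonoOn (fun x : ℝ => 2 - 2 * Real.cosh x + x * Real.sinh x) (Ici 0) := by
      have hd : ∀ x : ℝ, HasDerivAt (fun x : ℝ => 2 - 2 * Real.cosh x + x * Real.sinh x)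
          (x * Real.cosh x - Real.sinh x) x := fun x => by
        refine ((((Real.hasDerivAt_cosh x).const_mul 2).const_sub 2).add
          ((hasDerivAt_id x).mul (Real.hasDerivAt_sinh x))).congr_deriv ?_
        simp; ring
      refine strictMonoOn_of_deriv_pos (convex_Ici 0) (by fun_prop) fun y hy => ?_
      rw [interior_Ici, mem_Ioi] at hy
      rw [(hd y).deriv]
      linarith [xcosh_gt hy]
    have := h (mem_Ici.2 le_rfl) (mem_Ici.2 hx.le) hx
    simpa using this
  have h : StrictMonoOn (fun x : ℝ => x * (2 + Real.cosh x) - 3 * Real.sinh x) (Ici 0) := by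
    have hd : ∀ x : ℝ, HasDerivAt (fun x : ℝ => x * (2 + Real.cosh x) - 3 * Real.sinh x)
        (2 - 2 * Real.cosh x + x * Real.sinh x) x := fun x => by
      refine (((hasDerivAt_id x).mul ((Real.hasDerivAt_cosh x).const_add 2)).sub
        ((Real.hasDerivAt_sinh x).const_mul 3)).congr_deriv ?_
      simp; ring
    refine strictMonoOn_of_deriv_pos (convex_Ici 0) (by fun_prop) fun y hy => ?_
    rw [interior_Ici, mem_Ioi] at hy
    rw [(hd y).deriv]
    exact h1 y hy
  have := h (mem_Ici.2 le_rfl) (mem_Ici.2 hx.le) hx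
  simp at this
  linarith

/-- `x coth x`. -/
def phi0 (x : ℝ) : ℝ := x * Real.cosh x / Real.sinh x
/-- First derivative of `phi0`. -/
def phi1 (x : ℝ) : ℝ := Real.cosh x / Real.sinh x - x / Real.sinh x ^ 2
/-- Second derivative of `phi0`. -/
def phi2 (x : ℝ) : ℝ := 2 * (x * Real.cosh x - Real.sinh x) / Real.sinh x ^ 3

lemma phi0_deriv {x : ℝ} (hx : 0 < x) : HasDerivAt phi0 (phi1 x) x := by
  have hs := (Real.sinh_pos_iff.2 hx).ne'
  refine (((hasDerivAt_id x).mul (Real.hasDerivAt_cosh x)).div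
    (Real.hasDerivAt_sinh x) hs).congr_deriv ?_
  have := Real.cosh_sq x
  simp only [phi1, id]
  simp
  field_simp
  linear_combination (-x) * this

lemma phi1_deriv {x : ℝ} (hx : 0 < x) : HasDerivAt phi1 (phi2 x) x := by
  have hs := (Real.sinh_pos_iff.2 hx).ne'
  refine (((Real.hasDerivAt_cosh x).div (Real.hasDerivAt_sinh x) hs).sub
    ((hasDerivAt_id x).div ((Real.hasDerivAt_sinh x).pow 2) (pow_ne_zero 2 hs))).congr_deriv ?_
  have := Real.cosh_sq x
  simp only [phi2, id]
  simp
  field_simp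
  linear_combination (-Real.sinh x) * this

lemma phi2_deriv {x : ℝ} (hx : 0 < x) : HasDerivAt phi2
    (2 * (x * Real.sinh x ^ 2 - 3 * x * Real.cosh x ^ 2 + 3 * Real.sinh x * Real.cosh x) /
      Real.sinh x ^ 4) x := by
  have hs := (Real.sinh_pos_iff.2 hx).ne'
  refine ((((((hasDerivAt_id x).mul (Real.hasDerivAt_cosh x)).sub
    (Real.hasDerivAt_sinh x)).const_mul 2)).div
    ((Real.hasDerivAt_sinh x).pow 3) (pow_ne_zero 3 hs)).congr_deriv ?_
  simp only [id]
  simp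
  field_simp
  ring

lemma phi2_anti : StrictAntiOn phi2 (Ioi 0) := by
  refine strictAntiOn_of_deriv_neg (convex_Ioi 0)
    (fun x hx => (phi2_deriv hx).continuousAt.continuousWithinAt) fun x hx => ?_
  rw [interior_Ioi, mem_Ioi] at hx
  rw [(phi2_deriv hx).deriv]
  have hs := Real.sinh_pos_iff.2 hx
  apply div_neg_of_neg_of_pos _ (by positivity)
  have c := cusa (x := 2 * x) (by linarith)
  rw [Real.sinh_two_mul, Real.cosh_two_mul] at c
  nlinarith [Real.cosh_sq x]

lemma phi1_concave : StrictConcaveOn ℝ (Ioi 0) phi1 := by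
  refine StrictAntiOn.strictConcaveOn_of_deriv (convex_Ioi 0)
    (fun x hx => (phi1_deriv hx).continuousAt.continuousWithinAt) ?_
  rw [interior_Ioi]
  intro x hx y hy hxy
  rw [(phi1_deriv hx).deriv, (phi1_deriv hy).deriv]
  exact phi2_anti hx hy hxy

lemma phi0_ineq {c d : ℝ} (hd : 0 < d) (hcd : 2 * d < c) :
    0 < 2 * (phi0 (c + d) - phi0 (c - d)) - (phi0 (c + 2 * d) - phi0 (c - 2 * d)) := by
  have hD : ∀ x ∈ Ico 0 (c / 2), HasDerivAt
      (fun d => 2 * (phi0 (c + d) - phi0 (c - d)) - (phi0 (c + 2 * d) - phi0 (c - 2 * d)))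
      (2 * (phi1 (c + x) + phi1 (c - x)) - (phi1 (c + 2 * x) * 2 + phi1 (c - 2 * x) * 2)) x := by
    rintro x ⟨hx0, hx⟩
    have a1 := HasDerivAt.comp x (phi0_deriv (x := c + x) (by linarith))
      ((hasDerivAt_id x).const_add c)
    have a2 := HasDerivAt.comp x (phi0_deriv (x := c - x) (by linarith))
      ((hasDerivAt_id x).const_sub c)
    have a3 := HasDerivAt.comp x (phi0_deriv (x := c + 2 * x) (by linarith))
      (((hasDerivAt_id x).const_mul 2).const_add c)
    have a4 := HasDerivAt.comp x (phi0_deriv (x := c - 2 * x) (by linarith))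
      (((hasDerivAt_id x).const_mul 2).const_sub c)
    refine (((a1.sub a2).const_mul 2).sub (a3.sub a4)).congr_deriv ?_
    ring
  have hm : StrictMonoOn
      (fun d => 2 * (phi0 (c + d) - phi0 (c - d)) - (phi0 (c + 2 * d) - phi0 (c - 2 * d)))
      (Ico 0 (c / 2)) := by
    refine strictMonoOn_of_deriv_pos (convex_Ico _ _)
      (fun x hx => (hD x hx).continuousAt.continuousWithinAt) fun x hx => ?_
    rw [(hD x (interior_subset hx)).deriv]
    rw [interior_Ico] at hx
    obtain ⟨hx0, hx⟩ := hx
    have m1 : c + 2 * x ∈ Ioi (0:ℝ) := by rw [mem_Ioi]; linarith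
    have m2 : c - 2 * x ∈ Ioi (0:ℝ) := by rw [mem_Ioi]; linarith
    have ne : c + 2 * x ≠ c - 2 * x := by intro h; linarith
    have k1 := phi1_concave.2 m1 m2 ne (show (0:ℝ) < 3 / 4 by norm_num)
      (show (0:ℝ) < 1 / 4 by norm_num) (by norm_num)
    have k2 := phi1_concave.2 m1 m2 ne (show (0:ℝ) < 1 / 4 by norm_num)
      (show (0:ℝ) < 3 / 4 by norm_num) (by norm_num)
    simp only [smul_eq_mul] at k1 k2
    have e1 : 3 / 4 * (c + 2 * x) + 1 / 4 * (c - 2 * x) = c + x := by ring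
    have e2 : 1 / 4 * (c + 2 * x) + 3 / 4 * (c - 2 * x) = c - x := by ring
    rw [e1] at k1
    rw [e2] at k2
    linarith
  have := hm (show (0:ℝ) ∈ Ico 0 (c / 2) from ⟨le_rfl, by linarith⟩)
    (show d ∈ Ico 0 (c / 2) from ⟨hd.le, by linarith⟩) hd
  simpa using this

/-- Logarithm of the factors, in the hyperbolic variable. -/
def logT (m u : ℝ) : ℝ := 2 * Real.log (Real.sinh ((m + 1) * u)) +
  Real.log (Real.sinh ((m - 2) * u)) - 2 * Real.log (Real.sinh ((m - 1) * u)) -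
  Real.log (Real.sinh ((m + 2) * u))

lemma logsinh_deriv {k u : ℝ} (hk : 0 < k) (hu : 0 < u) :
    HasDerivAt (fun u => Real.log (Real.sinh (k * u))) (phi0 (k * u) / u) u := by
  have hs := (Real.sinh_pos_iff.2 (mul_pos hk hu)).ne'
  have := ((Real.hasDerivAt_sinh (k * u)).comp u ((hasDerivAt_id u).const_mul k)).log hs
  refine this.congr_deriv ?_
  simp [phi0]
  field_simp

lemma logT_mono {m : ℝ} (hm : 2 < m) : StrictMonoOn (logT m) (Ioi 0) := by
  have hd : ∀ u, 0 < u → HasDerivAt (logT m) (2 * (phi0 ((m + 1) * u) / u) +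
      phi0 ((m - 2) * u) / u - 2 * (phi0 ((m - 1) * u) / u) - phi0 ((m + 2) * u) / u) u := by
    intro u hu
    exact ((((logsinh_deriv (k := m + 1) (by linarith) hu).const_mul 2).add
      (logsinh_deriv (k := m - 2) (by linarith) hu)).sub
      ((logsinh_deriv (k := m - 1) (by linarith) hu).const_mul 2)).sub
      (logsinh_deriv (k := m + 2) (by linarith) hu)
  refine strictMonoOn_of_deriv_pos (convex_Ioi _)
      (fun x hx => (hd x hx).continuousAt.continuousWithinAt) fun u hu => ?_
  rw [interior_Ioi, mem_Ioi] at hu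
  rw [(hd u hu).deriv]
  have := phi0_ineq (c := m * u) hu (by nlinarith)
  have e1 : m * u + u = (m + 1) * u := by ring
  have e2 : m * u - u = (m - 1) * u := by ring
  have e3 : m * u + 2 * u = (m + 2) * u := by ring
  have e4 : m * u - 2 * u = (m - 2) * u := by ring
  rw [e1, e2, e3, e4] at this
  have h2 := div_pos this hu
  refine h2.trans_eq ?_
  ring

/-- The factors. -/
def facT (k : ℕ) (q : ℝ) : ℝ :=
  ((1 - q ^ (4 * k + 4)) / (1 - q ^ (4 * k + 2))) ^ 2 *
    ((1 - q ^ (4 * k + 1)) / (1 - q ^ (4 * k + 5)))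

lemma one_sub_exp (j : ℕ) (u : ℝ) :
    1 - Real.exp (-(2 * u)) ^ j = 2 * Real.exp (-(j * u)) * Real.sinh (j * u) := by
  rw [Real.sinh_eq, ← Real.exp_nat_mul]
  have a : Real.exp (-(j * u)) * Real.exp (j * u) = 1 := by rw [← Real.exp_add]; simp
  have b : Real.exp (-(j * u)) * Real.exp (-(j * u)) = Real.exp (j * (-(2 * u))) := by
    rw [← Real.exp_add]; congr 1; ring
  linear_combination b - a

lemma facT_eq (k : ℕ) {u : ℝ} (hu : 0 < u) :
    facT k (Real.exp (-(2 * u))) = Real.exp (logT (4 * k + 3) u) := by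
  have s : ∀ x : ℝ, 0 < x → Real.exp (Real.log (Real.sinh (x * u))) = Real.sinh (x * u) :=
    fun x hx => Real.exp_log (Real.sinh_pos_iff.2 (mul_pos hx hu))
  have k0 : (0:ℝ) ≤ k := Nat.cast_nonneg k
  have d : ∀ y : ℝ, Real.exp (2 * y) = Real.exp y * Real.exp y := fun y => by
    rw [two_mul, Real.exp_add]
  rw [logT, Real.exp_sub, Real.exp_sub, Real.exp_add, d (Real.log _), d (Real.log _),
    s _ (by linarith), s _ (by linarith), s _ (by linarith), s _ (by linarith), facT,
    one_sub_exp, one_sub_exp, one_sub_exp, one_sub_exp]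
  push_cast
  have n : ∀ x : ℝ, 0 < x → Real.sinh (x * u) ≠ 0 :=
    fun x hx => (Real.sinh_pos_iff.2 (mul_pos hx hu)).ne'
  have n1 := n (4 * k + 1) (by linarith)
  have n2 := n (4 * k + 2) (by linarith)
  have n4 := n (4 * k + 4) (by linarith)
  have n5 := n (4 * k + 5) (by linarith)
  have e1 : (4 * k + 3 - 2 : ℝ) = 4 * k + 1 := by ring
  have e2 : (4 * k + 3 - 1 : ℝ) = 4 * k + 2 := by ring
  have e4 : (4 * k + 3 + 1 : ℝ) = 4 * k + 4 := by ring
  have e5 : (4 * k + 3 + 2 : ℝ) = 4 * k + 5 := by ring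
  rw [e1, e2, e4, e5]
  have ex : (Real.exp (-((4 * k + 4) * u))) ^ 2 * Real.exp (-((4 * k + 1) * u)) =
    (Real.exp (-((4 * k + 2) * u))) ^ 2 * Real.exp (-((4 * k + 5) * u)) := by
    rw [← Real.exp_nat_mul, ← Real.exp_nat_mul, ← Real.exp_add, ← Real.exp_add]
    congr 1; push_cast; ring
  have p2 := (Real.exp_pos (-((4 * k + 2) * u))).ne'
  have p5 := (Real.exp_pos (-((4 * k + 5) * u))).ne'
  generalize Real.sinh ((4 * k + 1) * u) = S1 at *
  generalize Real.sinh ((4 * k + 2) * u) = S2 at *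
  generalize Real.sinh ((4 * k + 4) * u) = S4 at *
  generalize Real.sinh ((4 * k + 5) * u) = S5 at *
  generalize Real.exp (-((4 * k + 1) * u)) = E1 at *
  generalize Real.exp (-((4 * k + 2) * u)) = E2 at *
  generalize Real.exp (-((4 * k + 4) * u)) = E4 at *
  generalize Real.exp (-((4 * k + 5) * u)) = E5 at *
  field_simp
  linear_combination ex

lemma facT_pos (k : ℕ) {q : ℝ} (h0 : 0 < q) (h1 : q < 1) : 0 < facT k q := by
  have h : ∀ j : ℕ, j ≠ 0 → 0 < 1 - q ^ j := fun j hj => by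
    linarith [pow_lt_one₀ h0.le h1 hj]
  have a1 := h (4 * k + 1) (by omega)
  have a2 := h (4 * k + 2) (by omega)
  have a4 := h (4 * k + 4) (by omega)
  have a5 := h (4 * k + 5) (by omega)
  unfold facT
  positivity

lemma facT_anti (k : ℕ) {q q' : ℝ} (h0 : 0 < q) (h : q < q') (h1 : q' < 1) :
    facT k q' < facT k q := by
  have e : ∀ x : ℝ, 0 < x → Real.exp (-(2 * (-Real.log x / 2))) = x := fun x hx => by
    rw [show -(2 * (-Real.log x / 2)) = Real.log x by ring, Real.exp_log hx]
  have l1 : Real.log q < Real.log q' := Real.log_lt_log h0 h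
  have l2 : Real.log q' < 0 := Real.log_neg (h0.trans h) h1
  rw [← e q h0, ← e q' (h0.trans h), facT_eq k (by linarith), facT_eq k (by linarith)]
  apply Real.exp_lt_exp.2
  have k0 : (0:ℝ) ≤ k := Nat.cast_nonneg k
  exact logT_mono (by linarith) (mem_Ioi.2 (by linarith)) (mem_Ioi.2 (by linarith)) (by linarith)

/-- The ratio as a function of `q = ρ^2`. -/
def ratQ (q : ℝ) : ℝ :=
  (‖qE (q ^ 4) ((q : ℂ) ^ 4)‖ / ‖qE (q ^ 4) ((q : ℂ) ^ 2)‖) ^ 2 * (1 - q)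

lemma ratQ_pos {q : ℝ} (h0 : 0 < q) (h1 : q < 1) : 0 < ratQ q := by
  have p0 : 0 < q ^ 4 := by positivity
  have p1 : q ^ 4 < 1 := pow_lt_one₀ h0.le h1 (by norm_num)
  have p2 : q ^ 2 < 1 := pow_lt_one₀ h0.le h1 (by norm_num)
  have a := norm_pos_iff.2 (qE_ne p0 p1 (x := (q : ℂ) ^ 4) (by simpa [abs_of_pos h0] using p1))
  have b := norm_pos_iff.2 (qE_ne p0 p1 (x := (q : ℂ) ^ 2) (by simpa [abs_of_pos h0] using p2))
  have : 0 < 1 - q := by linarith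
  unfold ratQ
  positivity

lemma prod_facT {q : ℝ} (h0 : 0 < q) (h1 : q < 1) (N : ℕ) :
    ∏ k ∈ Finset.range N, facT k q =
      (‖∏ k ∈ Finset.range N, (1 - ((q ^ 4 : ℝ) : ℂ) ^ k * (q : ℂ) ^ 4)‖ /
       ‖∏ k ∈ Finset.range N, (1 - ((q ^ 4 : ℝ) : ℂ) ^ k * (q : ℂ) ^ 2)‖) ^ 2 *
      ((1 - q) / (1 - q ^ (4 * N + 1))) := by
  have h : ∀ j : ℕ, j ≠ 0 → 0 < 1 - q ^ j := fun j hj => by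
    linarith [pow_lt_one₀ h0.le h1 hj]
  have hn : ∀ k j : ℕ, j ≠ 0 → ‖1 - ((q ^ 4 : ℝ) : ℂ) ^ k * (q : ℂ) ^ j‖ =
      1 - q ^ (4 * k + j) := fun k j hj => by
    have : (1 - ((q ^ 4 : ℝ) : ℂ) ^ k * (q : ℂ) ^ j) = ((1 - q ^ (4 * k + j) : ℝ) : ℂ) := by
      push_cast; ring
    rw [this, Complex.norm_real, Real.norm_eq_abs, abs_of_pos (h _ (by omega))]
  induction N with
  | zero => simp; rw [div_self]; linarith
  | succ N ih =>
    rw [Finset.prod_range_succ, ih, Finset.prod_range_succ, Finset.prod_range_succ, norm_mul,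
      norm_mul, hn N 4 (by norm_num), hn N 2 (by norm_num), facT]
    have a1 := (h (4 * N + 1) (by omega)).ne'
    have e : 4 * (N + 1) + 1 = 4 * N + 5 := by ring
    rw [e]
    rw [mul_div_mul_comm, mul_pow]
    generalize (‖∏ k ∈ Finset.range N, (1 - ((q ^ 4 : ℝ) : ℂ) ^ k * (q : ℂ) ^ 4)‖ /
       ‖∏ k ∈ Finset.range N, (1 - ((q ^ 4 : ℝ) : ℂ) ^ k * (q : ℂ) ^ 2)‖) ^ 2 = X
    generalize ((1 - q ^ (4 * N + 4)) / (1 - q ^ (4 * N + 2))) ^ 2 = Y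
    have : (1 - q) / (1 - q ^ (4 * N + 1)) * ((1 - q ^ (4 * N + 1)) / (1 - q ^ (4 * N + 5))) =
        (1 - q) / (1 - q ^ (4 * N + 5)) := div_mul_div_cancel₀ a1
    linear_combination X * Y * this

lemma ratQ_tendsto {q : ℝ} (h0 : 0 < q) (h1 : q < 1) :
    Tendsto (fun N => ∏ k ∈ Finset.range N, facT k q) atTop (𝓝 (ratQ q)) := by
  have p0 : 0 < q ^ 4 := by positivity
  have p1 : q ^ 4 < 1 := pow_lt_one₀ h0.le h1 (by norm_num)
  have p2 : q ^ 2 < 1 := pow_lt_one₀ h0.le h1 (by norm_num)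
  have b := norm_pos_iff.2 (qE_ne p0 p1 (x := (q : ℂ) ^ 2) (by simpa [abs_of_pos h0] using p2))
  simp_rw [prod_facT h0 h1]
  have t := (tendsto_pow_atTop_nhds_zero_of_lt_one h0.le h1).comp
    (tendsto_atTop_mono (fun n : ℕ => (by omega : n ≤ 4 * n + 1)) tendsto_id)
  have t2 : Tendsto (fun N : ℕ => (1 - q) / (1 - q ^ (4 * N + 1))) atTop (𝓝 ((1 - q) / (1 - 0))) :=
    (tendsto_const_nhds (x := 1 - q)).div (t.const_sub 1) (by norm_num)
  rw [sub_zero, div_one] at t2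
  exact (((qE_tendsto p0 p1 _).norm.div (qE_tendsto p0 p1 _).norm b.ne').pow 2).mul t2

lemma ratQ_anti {q q' : ℝ} (h0 : 0 < q) (h : q < q') (h1 : q' < 1) : ratQ q' < ratQ q := by
  have h0' := h0.trans h
  have h1' := h.trans h1
  have t := (tendsto_add_atTop_iff_nat 1).2 (ratQ_tendsto h0 h1')
  have t' := (tendsto_add_atTop_iff_nat 1).2 (ratQ_tendsto h0' h1)
  have f0 := facT_pos 0 h0 h1'
  have f0' := facT_pos 0 h0' h1
  have key : ∀ N, ∏ k ∈ Finset.range (N + 1), facT k q' ≤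
      facT 0 q' / facT 0 q * ∏ k ∈ Finset.range (N + 1), facT k q := by
    intro N
    induction N with
    | zero => simp; rw [div_mul_cancel₀ _ f0.ne']
    | succ N ih =>
      rw [Finset.prod_range_succ _ (N + 1), Finset.prod_range_succ _ (N + 1), ← mul_assoc]
      refine mul_le_mul ih (facT_anti (N + 1) h0 h h1).le (facT_pos (N + 1) h0' h1).le ?_
      have : 0 ≤ ∏ k ∈ Finset.range (N + 1), facT k q :=
        Finset.prod_nonneg fun k _ => (facT_pos k h0 h1').le
      exact mul_nonneg (div_nonneg f0'.le f0.le) this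
  have le := le_of_tendsto_of_tendsto' t' (t.const_mul _) key
  refine le.trans_lt ?_
  have hk : facT 0 q' / facT 0 q < 1 := (div_lt_one f0).2 (facT_anti 0 h0 h h1)
  have := ratQ_pos h0 h1'
  nlinarith

/-! ### The main theorem -/

lemma ratio_eq {ρ c r : ℝ} (h0 : 0 < ρ) (h1 : ρ < 1) (hc : 0 < c)
    (hr : r = 2 * c * ρ / (1 + ρ ^ 2)) :
    analyticCapacity (closedBall (-(c:ℂ)) r ∪ closedBall (c:ℂ) r) / (2 * r) = ratQ (ρ ^ 2) := by
  rw [cap_eq h0 h1 hc hr rfl]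
  have hU : ‖ahlU ρ 1‖ =
      ρ * (‖qE ((ρ ^ 2) ^ 4) (((ρ ^ 2 : ℝ) : ℂ) ^ 4)‖ /
        ‖qE ((ρ ^ 2) ^ 4) (((ρ ^ 2 : ℝ) : ℂ) ^ 2)‖) ^ 2 := by
    have e1 : (ρ ^ 2) ^ 4 = ρ ^ 8 := by ring
    have e2 : ((ρ ^ 2 : ℝ) : ℂ) ^ 4 = (ρ : ℂ) ^ 8 := by push_cast; ring
    have e3 : ((ρ ^ 2 : ℝ) : ℂ) ^ 2 = (ρ : ℂ) ^ 4 := by push_cast; ring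
    rw [e1, e2, e3]
    simp only [ahlU, inv_one, one_pow, mul_one, norm_div, norm_mul, Complex.norm_real,
      Real.norm_eq_abs, abs_of_pos h0]
    ring
  rw [hU, ratQ, hr]
  generalize (‖qE ((ρ ^ 2) ^ 4) (((ρ ^ 2 : ℝ) : ℂ) ^ 4)‖ /
        ‖qE ((ρ ^ 2) ^ 4) (((ρ ^ 2 : ℝ) : ℂ) ^ 2)‖) ^ 2 = X
  have hp : 1 + ρ ^ 2 ≠ 0 := by positivity
  field_simp
  ring

lemma exists_rho {c r : ℝ} (hr : r ∈ Set.Ioo 0 c) :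
    ∃ ρ : ℝ, 0 < ρ ∧ ρ < 1 ∧ r = 2 * c * ρ / (1 + ρ ^ 2) := by
  obtain ⟨hr0, hrc⟩ := hr
  have hc : 0 < c := hr0.trans hrc
  have hcont : ContinuousOn (fun ρ : ℝ => 2 * c * ρ / (1 + ρ ^ 2)) (Icc 0 1) := by
    apply Continuous.continuousOn
    exact Continuous.div (by fun_prop) (by fun_prop) fun x => by positivity
  have := intermediate_value_Ioo (zero_le_one (α := ℝ)) hcont
  obtain ⟨ρ, hρ, h⟩ := this (show r ∈ Ioo _ _ from by constructor <;> norm_num <;> linarith)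
  exact ⟨ρ, hρ.1, hρ.2, h.symm⟩

/-- For `c > 0`, the function `r ↦ γ(D̄(−c,r) ∪ D̄(c,r)) / (2r)` is strictly
decreasing on `(0, c)`; i.e. for two disjoint closed disks `E, F` of the same radius `r`
with centers at distance `2c`, the ratio `γ(E ∪ F)/(γ(E) + γ(F))` strictly decreases in `r`. -/
theorem ratio_two_disks_strictAnti (c : ℝ) (hc : 0 < c) :
    StrictAntiOn (fun r : ℝ =>
      analyticCapacity (closedBall (-(c:ℂ)) r ∪ closedBall ((c:ℂ)) r) / (2 * r))
      (Set.Ioo 0 c) := by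
  intro r hr r' hr' hlt
  obtain ⟨ρ, h0, h1, e⟩ := exists_rho hr
  obtain ⟨ρ', h0', h1', e'⟩ := exists_rho hr'
  simp only
  rw [ratio_eq h0 h1 hc e, ratio_eq h0' h1' hc e']
  have hlt' : ρ < ρ' := by
    by_contra! hle
    rw [e, e', div_lt_div_iff₀ (by positivity) (by positivity)] at hlt
    have hs : 0 < c * (1 - ρ * ρ') := mul_pos hc (by nlinarith)
    nlinarith [mul_nonneg hs.le (sub_nonneg.2 hle)]
  refine ratQ_anti (by positivity) (by gcongr) ?_
  nlinarith
end
end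

section
/- Let Ω ⊆ ℂ∞ be a finitely connected domain containing ∞ with piecewise-analytic boundary, let E ⊂ ∂Ω be the finite set of endpoints of the analytic arcs of ∂Ω (the corner points), let Ω̃ be a finitely connected domain with analytic boundary, and let F : Ω → Ω̃ be a conformal map with F(∞) = ∞. Then F′ has an analytic square root: there exists a function h, holomorphic in Ω and continuous on Ω̄ ∖ E, such that h(z)² = F′(z) for all z ∈ Ω̄ ∖ E. -/
open Complex Filter Metric Set Topology Bornology MeasureTheory

noncomputable section

/-- Data exhibiting the boundary of a domain `Ω ⊆ ℂ` as a finite union of pairwise disjoint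
piecewise-analytic Jordan curves: each curve is a `1`-periodic continuous (rectifiable,
i.e. Lipschitz) parametrization, injective on a period, real-analytic and regular except at a
finite set `corners` of boundary points where two analytic arcs meet, and at every corner
`Ω` is conformally equivalent to a sector `{ρ e^{iθ} : 0 < ρ < 1, 0 < θ < α}`, `0 < α < 2π`. -/
structure PABoundary (Ω : Set ℂ) where
  n : ℕ
  npos : 0 < n
  curve : Fin n → ℝ → ℂ
  cont : ∀ i, Continuous (curve i)
  rectifiable : ∀ i, ∃ M : NNReal, LipschitzWith M (curve i)
  periodic : ∀ i, Function.Periodic (curve i) 1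
  injOn : ∀ i, Set.InjOn (curve i) (Set.Ico (0:ℝ) 1)
  boundary : (⋃ i, Set.range (curve i)) = frontier Ω
  disjointCurves : ∀ i j, i ≠ j → Disjoint (Set.range (curve i)) (Set.range (curve j))
  corners : Finset ℂ
  cornersOnBoundary : (corners : Set ℂ) ⊆ frontier Ω
  analyticArc : ∀ i t, curve i t ∉ corners →
    AnalyticAt ℝ (curve i) t ∧ deriv (curve i) t ≠ 0
  sector : ∀ w ∈ corners, ∃ α : ℝ, 0 < α ∧ α < 2 * Real.pi ∧
    ∃ V ∈ 𝓝 w, ∃ φ : ℂ → ℂ,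
      DifferentiableOn ℂ φ (V ∩ Ω) ∧ Set.InjOn φ (V ∩ Ω) ∧
      φ '' (V ∩ Ω) = {z : ℂ | ∃ ρ θ : ℝ, 0 < ρ ∧ ρ < 1 ∧ 0 < θ ∧ θ < α ∧
        z = (ρ : ℂ) * Complex.exp ((θ : ℂ) * Complex.I)}

/-- The contour integral `∫_{∂Ω} f(ζ) dζ` over a finite family of parametrized curves. -/
def contourIntegralOf {n : ℕ} (curve : Fin n → ℝ → ℂ) (f : ℂ → ℂ) : ℂ :=
  ∑ i, ∫ t in (0:ℝ)..1, f (curve i t) * deriv (curve i) t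

/-- The arc-length integral `∫_{∂Ω} f(ζ) |dζ|` over a finite family of parametrized curves. -/
def arcIntegralOf {n : ℕ} (curve : Fin n → ℝ → ℂ) (f : ℂ → ℝ) : ℝ :=
  ∑ i, ∫ t in (0:ℝ)..1, f (curve i t) * ‖deriv (curve i) t‖

/-- The family of curves is positively (counterclockwise) oriented as the boundary of the
complement of `K`: the total winding number around each point of `interior K` is `1`. -/
def PositivelyOriented {n : ℕ} (curve : Fin n → ℝ → ℂ) (K : Set ℂ) : Prop :=
  ∀ w ∈ interior K,
    (∑ i, ∫ t in (0:ℝ)..1, deriv (curve i) t / (curve i t - w)) = 2 * Real.pi * Complex.I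

/-- A finite family of pairwise disjoint rectifiable (Lipschitz) Jordan curves tracing the
frontier of a set `U ⊆ ℂ`. -/
structure RectCurves (U : Set ℂ) where
  n : ℕ
  curve : Fin n → ℝ → ℂ
  rectifiable : ∀ i, ∃ M : NNReal, LipschitzWith M (curve i)
  periodic : ∀ i, Function.Periodic (curve i) 1
  injOn : ∀ i, Set.InjOn (curve i) (Set.Ico (0:ℝ) 1)
  boundary : (⋃ i, Set.range (curve i)) = frontier U
  disjointCurves : ∀ i j, i ≠ j → Disjoint (Set.range (curve i)) (Set.range (curve j))

/-- The Smirnov class `E^p(Ω)`: holomorphic functions `h` on `Ω` for which there is a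
sequence of finitely connected subdomains `U k ⊆ Ω` with rectifiable boundaries such that
(i) the `U k` eventually contain each compact subset of `Ω`; (ii) the integrals of `|h|^p`
over the boundaries are (eventually) bounded, i.e. `limsup ∫_{∂U k} |h|^p |dz| < ∞`;
(iii) the lengths of the boundary curves are uniformly bounded. -/
def MemSmirnov (p : ℝ) (Ω : Set ℂ) (h : ℂ → ℂ) : Prop :=
  DifferentiableOn ℂ h Ω ∧
  ∃ (U : ℕ → Set ℂ) (B : ∀ k, RectCurves (U k)),
    (∀ k, U k ⊆ Ω ∧ IsOpen (U k) ∧ IsConnected (U k)) ∧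
    (∀ C : Set ℂ, IsCompact C → C ⊆ Ω → ∃ N, ∀ k ≥ N, C ⊆ U k) ∧
    (∃ L : ℝ, ∀ k i, eVariationOn ((B k).curve i) (Set.Icc 0 1) ≤ ENNReal.ofReal L) ∧
    (∃ M : ℝ, ∀ᶠ k in atTop,
      arcIntegralOf ((B k).curve) (fun z => ‖h z‖ ^ p) ≤ M)

/-- `w` is the nontangential limit of `h` at the boundary point `ζ` of the domain `Ω`:
`h(z) → w` as `z → ζ` inside each Stolz-type region `{z ∈ Ω : |z − ζ| ≤ c·dist(z, ∂Ω)}`. -/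
def NTLimAt (Ω : Set ℂ) (h : ℂ → ℂ) (ζ w : ℂ) : Prop :=
  ∀ c : ℝ, 0 < c →
    Tendsto h (𝓝[{z | z ∈ Ω ∧ dist z ζ ≤ c * infDist z Ωᶜ}] ζ) (𝓝 w)

/-- `hstar` is a nontangential boundary-value function of `h` on the boundary of `Ω`
parametrized by the given curves: for each curve and almost every parameter `t`, `h` has
nontangential limit `hstar (curve i t)` at `curve i t`. -/
def IsNTBoundaryValue (Ω : Set ℂ) {n : ℕ} (curve : Fin n → ℝ → ℂ)
    (h hstar : ℂ → ℂ) : Prop :=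
  ∀ i, ∀ᵐ t ∂(volume : Measure ℝ), t ∈ Set.Icc (0:ℝ) 1 →
    NTLimAt Ω h (curve i t) (hstar (curve i t))

/-- Data exhibiting the boundary of a domain `Ω ⊆ ℂ` as a finite union of pairwise disjoint
analytic Jordan curves: `1`-periodic real-analytic regular parametrizations, injective on a
period, with pairwise disjoint images whose union is the frontier of `Ω`. -/
structure AnalyticBoundary (Ω : Set ℂ) where
  n : ℕ
  npos : 0 < n
  curve : Fin n → ℝ → ℂ
  analyticCurve : ∀ i t, AnalyticAt ℝ (curve i) t
  regular : ∀ i t, deriv (curve i) t ≠ 0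
  periodic : ∀ i, Function.Periodic (curve i) 1
  injOn : ∀ i, Set.InjOn (curve i) (Set.Ico (0:ℝ) 1)
  boundary : (⋃ i, Set.range (curve i)) = frontier Ω
  disjointCurves : ∀ i j, i ≠ j → Disjoint (Set.range (curve i)) (Set.range (curve j))

lemma aux_deriv_ne_zero {F : ℂ → ℂ} {U : Set ℂ} (hU : IsOpen U) (hF : DifferentiableOn ℂ F U)
    (hinj : InjOn F U) {a : ℂ} (ha : a ∈ U) : deriv F a ≠ 0 := by
  intro hd
  have hUa : U ∈ 𝓝 a := hU.mem_nhds ha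
  have hFa : AnalyticAt ℂ F a := hF.analyticAt hUa
  have hfa : AnalyticAt ℂ (fun z => F z - F a) a := hFa.sub analyticAt_const
  have hnz : ¬ ∀ᶠ z in 𝓝 a, F z - F a = 0 := by
    intro h
    have h1 : ∀ᶠ z in 𝓝[≠] a, z = a := by
      filter_upwards [h.filter_mono nhdsWithin_le_nhds, mem_nhdsWithin_of_mem_nhds hUa]
        with z hz hzU
      exact hinj hzU ha (sub_eq_zero.1 hz)
    have h2 : ∀ᶠ z in 𝓝[≠] a, z ≠ a := eventually_mem_nhdsWithin
    obtain ⟨z, hz1, hz2⟩ := (h1.and h2).exists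
    exact hz2 hz1
  obtain ⟨n, g, hg, hga, hgn⟩ := hfa.exists_eventuallyEq_pow_smul_nonzero_iff.2 hnz
  have hn0 : n ≠ 0 := by
    rintro rfl
    have := hgn.self_of_nhds
    simp at this
    exact hga this.symm
  have hn1 : n ≠ 1 := by
    rintro rfl
    have h1 : HasDerivAt (fun z => (z - a) ^ 1 • g z) (g a) a := by
      have := ((hasDerivAt_id a).sub_const a).fun_mul hg.differentiableAt.hasDerivAt
      simpa using this
    have h2 : HasDerivAt (fun z => F z - F a) (g a) a := h1.congr_of_eventuallyEq hgn
    have h3 : HasDerivAt (fun z => F z - F a) (deriv F a) a :=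
      hFa.differentiableAt.hasDerivAt.sub_const _
    exact hga ((h2.unique h3).trans hd)
  have hnC : (n : ℂ) ≠ 0 := by exact_mod_cast hn0
  obtain ⟨c, hc⟩ : ∃ c : ℂ, c ^ n = g a := IsAlgClosed.exists_pow_nat_eq _ (Nat.pos_of_ne_zero hn0)
  have hc0 : c ≠ 0 := by
    rintro rfl
    rw [zero_pow hn0] at hc
    exact hga hc.symm
  set r : ℂ → ℂ := fun z => c * Complex.exp (Complex.log (g z / g a) / n) with hr
  have hra : r a = c := by simp [hr, hga]
  have hran : AnalyticAt ℂ r a := by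
    refine analyticAt_const.mul (AnalyticAt.cexp ?_)
    refine AnalyticAt.div (AnalyticAt.clog (hg.div analyticAt_const hga) ?_) analyticAt_const hnC
    simp [hga]
  have hgne : ∀ᶠ z in 𝓝 a, g z ≠ 0 := hg.continuousAt.eventually_ne hga
  have hrn : ∀ᶠ z in 𝓝 a, r z ^ n = g z := by
    filter_upwards [hgne] with z hz
    simp only [hr, mul_pow, ← Complex.exp_nat_mul, hc]
    rw [mul_div_cancel₀ _ hnC, Complex.exp_log (div_ne_zero hz hga), mul_div_cancel₀ _ hga]
  set φ : ℂ → ℂ := fun z => (z - a) * r z with hφ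
  have hφan : AnalyticAt ℂ φ a := (analyticAt_id.sub analyticAt_const).mul hran
  have hφd : deriv φ a = c := by
    have := ((hasDerivAt_id a).sub_const a).fun_mul hran.differentiableAt.hasDerivAt
    have h2 : HasDerivAt φ c a := by simpa [hra] using this
    exact h2.deriv
  have hφa : φ a = 0 := by simp [hφ]
  have hmap : map φ (𝓝 a) = 𝓝 0 := by
    have h := hφan.hasStrictDerivAt.map_nhds_eq (by rw [hφd]; exact hc0)
    rwa [hφa] at h
  have hS : {z | z ∈ U ∧ F z - F a = φ z ^ n} ∈ 𝓝 a := by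
    filter_upwards [hUa, hgn, hrn] with z h1 h2 h3
    refine ⟨h1, ?_⟩
    rw [h2]; simp [hφ, mul_pow, h3]
  have hT : φ '' {z | z ∈ U ∧ F z - F a = φ z ^ n} ∈ 𝓝 (0 : ℂ) := by
    rw [← hmap]; exact image_mem_map hS
  set ζ : ℂ := Complex.exp (2 * Real.pi * I / n) with hζ
  have hprim : IsPrimitiveRoot ζ n := Complex.isPrimitiveRoot_exp n hn0
  have hζ1 : ζ ≠ 1 := hprim.ne_one (by omega)
  have hT2 : (fun v => ζ * v) ⁻¹' (φ '' {z | z ∈ U ∧ F z - F a = φ z ^ n}) ∈ 𝓝 (0 : ℂ) := by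
    apply (continuous_const_mul ζ).continuousAt
    simpa using hT
  have h3 : ∀ᶠ v in 𝓝[≠] (0 : ℂ), v ≠ 0 := eventually_mem_nhdsWithin
  obtain ⟨v, hv0, ⟨z, ⟨hzU, hz⟩, hzv⟩, ⟨w, ⟨hwU, hw⟩, hwv⟩⟩ :=
    (h3.and (Filter.inter_mem (mem_nhdsWithin_of_mem_nhds hT)
      (mem_nhdsWithin_of_mem_nhds hT2))).exists
  have hwz : w = z := by
    apply hinj hwU hzU
    have : F w - F a = F z - F a := by
      rw [hz, hw, hzv, hwv, mul_pow, hprim.pow_eq_one, one_mul]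
    exact sub_left_injective this
  rw [hwz, hzv] at hwv
  apply hζ1
  have : (ζ - 1) * v = 0 := by rw [sub_mul, one_mul, sub_eq_zero]; exact hwv.symm
  rcases mul_eq_zero.1 this with h | h
  · exact sub_eq_zero.1 h
  · exact absurd h hv0

lemma aux_log_homotopy {A : Type*} [TopologicalSpace A] (H : unitInterval × A → ℂ)
    (hH : Continuous H) (h0 : ∀ x, H x ≠ 0) (l0 : A → ℂ) (hl0 : Continuous l0)
    (h00 : ∀ a, Complex.exp (l0 a) = H (0, a)) :
    ∃ L : A → ℂ, Continuous L ∧ ∀ a, Complex.exp (L a) = H (1, a) := by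
  let H' : C(unitInterval × A, {z : ℂ // z ≠ 0}) := ⟨fun x => ⟨H x, h0 x⟩, by fun_prop⟩
  have h1 : ∀ a, H' (0, a) = (fun z : ℂ ↦ (⟨_, z.exp_ne_zero⟩ : {z : ℂ // z ≠ 0}))
      ((⟨l0, hl0⟩ : C(A, ℂ)) a) := fun a => Subtype.ext (h00 a).symm
  have h2 := Complex.isCoveringMap_exp.liftHomotopy_lifts H' ⟨l0, hl0⟩ h1
  refine ⟨fun a => Complex.isCoveringMap_exp.liftHomotopy H' ⟨l0, hl0⟩ h1 (1, a), ?_, ?_⟩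
  · exact (ContinuousMap.continuous _).comp (by fun_prop)
  · intro a
    exact congrArg Subtype.val (congrFun h2 (1, a))

def auxG (F : ℂ → ℂ) (z w : ℂ) : ℂ := dslope F z w

lemma auxG_self (F : ℂ → ℂ) (z : ℂ) : auxG F z z = deriv F z := dslope_same _ _

lemma auxG_symm (F : ℂ → ℂ) (z w : ℂ) : auxG F z w = auxG F w z := by
  rcases eq_or_ne z w with rfl | h
  · rfl
  · rw [auxG, auxG, dslope_of_ne _ h.symm, dslope_of_ne _ h, slope_comm]

lemma auxG_ne_zero {F : ℂ → ℂ} {U : Set ℂ} (hU : IsOpen U) (hF : DifferentiableOn ℂ F U)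
    (hinj : InjOn F U) {z w : ℂ} (hz : z ∈ U) (hw : w ∈ U) : auxG F z w ≠ 0 := by
  rcases eq_or_ne w z with rfl | h
  · rw [auxG_self]; exact aux_deriv_ne_zero hU hF hinj hz
  · rw [auxG, dslope_of_ne _ h, slope_def_field]
    exact div_ne_zero (sub_ne_zero.2 fun e => h (hinj hw hz e)) (sub_ne_zero.2 h)

lemma auxG_cont {F : ℂ → ℂ} {U : Set ℂ} (hU : IsOpen U) (hF : DifferentiableOn ℂ F U) :
    Continuous (fun x : U × U => auxG F x.1 x.2) := by
  suffices h : ContinuousOn (fun x : ℂ × ℂ => auxG F x.1 x.2) (U ×ˢ U) by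
    exact h.comp_continuous (f := fun x : U × U => ((x.1 : ℂ), (x.2 : ℂ))) (by fun_prop)
      (fun x => ⟨x.1.2, x.2.2⟩)
  rintro ⟨a, b⟩ ⟨ha, hb⟩
  apply ContinuousAt.continuousWithinAt
  rcases eq_or_ne b a with rfl | hab
  · have hs := (hF.analyticAt (hU.mem_nhds ha)).hasStrictDerivAt
    rw [hasStrictDerivAt_iff_hasStrictFDerivAt, hasStrictFDerivAt_iff_isLittleO] at hs
    rw [Metric.continuousAt_iff']
    intro ε hε
    have h1 := hs.def (half_pos hε)
    have hc : ContinuousAt (deriv F) b := (hF.analyticAt (hU.mem_nhds ha)).deriv.continuousAt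
    have h2 : ∀ᶠ x : ℂ × ℂ in 𝓝 (b, b), dist (deriv F x.1) (deriv F b) < ε :=
      (continuousAt_fst (p := (b,b))).eventually (Metric.continuousAt_iff'.1 hc ε hε)
    filter_upwards [h1, h2] with x h1 h2
    rw [auxG_self F b]
    rcases eq_or_ne x.2 x.1 with e | e
    · rw [e, auxG_self]; exact h2
    · rw [auxG, dslope_of_ne _ e, slope_comm, slope_def_field, dist_eq_norm]
      have e' : x.1 - x.2 ≠ 0 := sub_ne_zero.2 e.symm
      have : (F x.1 - F x.2) / (x.1 - x.2) - deriv F b =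
        (F x.1 - F x.2 - (x.1 - x.2) • deriv F b) / (x.1 - x.2) := by
          field_simp; simp
      rw [this, norm_div]
      have : 0 < ‖x.1 - x.2‖ := norm_pos_iff.2 e'
      rw [div_lt_iff₀ this]
      refine h1.trans_lt ?_
      nlinarith
  · have hne : ∀ᶠ x : ℂ × ℂ in 𝓝 (a, b), x.2 ≠ x.1 :=
      (isOpen_ne_fun continuous_snd continuous_fst).mem_nhds hab
    have : (fun x : ℂ × ℂ => (F x.2 - F x.1) / (x.2 - x.1)) =ᶠ[𝓝 (a, b)]
        fun x : ℂ × ℂ => auxG F x.1 x.2 := by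
      filter_upwards [hne] with x hx
      rw [auxG, dslope_of_ne _ hx, slope_def_field]
    refine ContinuousAt.congr ?_ this
    have hca : ContinuousAt F a := (hF.continuousOn).continuousAt (hU.mem_nhds ha)
    have hcb : ContinuousAt F b := (hF.continuousOn).continuousAt (hU.mem_nhds hb)
    have hca' : ContinuousAt (fun x : ℂ × ℂ => F x.1) (a, b) :=
      ContinuousAt.comp (f := Prod.fst) (x := (a, b)) hca continuousAt_fst
    have hcb' : ContinuousAt (fun x : ℂ × ℂ => F x.2) (a, b) :=
      ContinuousAt.comp (f := Prod.snd) (x := (a, b)) hcb continuousAt_snd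
    exact (hcb'.sub hca').div (continuousAt_snd.sub continuousAt_fst) (sub_ne_zero.2 hab)


lemma aux_exp_unique {A : Type*} [TopologicalSpace A] [PreconnectedSpace A] {f g : A → ℂ}
    (hf : Continuous f) (hg : Continuous g) (h : ∀ a, Complex.exp (f a) = Complex.exp (g a))
    (a : A) (ha : f a = g a) : f = g :=
  Complex.isCoveringMap_exp.eq_of_comp_eq hf hg (funext fun x => Subtype.ext (h x)) a ha

lemma aux_diag_log {U : Set ℂ} (hU : IsOpen U) [PathConnectedSpace U] (p : U) (Q : U → U → ℂ)
    (hQc' : Continuous fun x : U × U => Q x.1 x.2) (hQ0 : ∀ z w, Q z w ≠ 0) (hQp : ∀ z, Q z p = 1)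
    (hpQ : ∀ w, Q p w = 1) :
    ∃ l : U → ℂ, Continuous l ∧ ∀ z, Complex.exp (l z) = Q z z := by
  have hQc : ∀ {A : Type} [TopologicalSpace A] {f g : A → U}, Continuous f → Continuous g →
      Continuous fun a => Q (f a) (g a) := fun hf hg => hQc'.comp (hf.prodMk hg)
  have hex : ∀ z : U, ∃ l : U → ℂ, Continuous l ∧ l p = 0 ∧ ∀ w, Complex.exp (l w) = Q z w := by
    intro z
    let γ := PathConnectedSpace.somePath p z
    obtain ⟨L, hL, hLe⟩ := aux_log_homotopy (A := U) (fun x => Q (γ x.1) x.2)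
      (hQc (γ.continuous.comp continuous_fst) continuous_snd) (fun x => hQ0 _ _) (fun _ => 0)
      continuous_const (by intro a; simp [hpQ])
    have hLe' : ∀ a, Complex.exp (L a) = Q z a := fun a => by rw [hLe]; simp
    refine ⟨fun w => L w - L p, hL.sub continuous_const, by simp, fun w => ?_⟩
    rw [Complex.exp_sub, hLe', hLe', hQp, div_one]
  choose l hlc hlp hle using hex
  have hdiag : Continuous fun z : U => l z z := by
    rw [continuous_iff_continuousAt]
    intro z0
    obtain ⟨r, hr, hrU⟩ := Metric.isOpen_iff.1 hU z0 z0.2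
    let S : Set U := {z | dist (z : ℂ) z0 < r}
    have hSo : IsOpen S := isOpen_lt (by fun_prop) continuous_const
    let m : unitInterval × (S × U) → U := fun x =>
      ⟨(z0 : ℂ) + (x.1 : ℝ) * ((x.2.1 : U) - (z0 : ℂ)), hrU (by
        rw [mem_ball, dist_eq_norm, add_sub_cancel_left, norm_mul]
        have h1 : ‖(((x.1 : ℝ)) : ℂ)‖ ≤ 1 := by
          rw [Complex.norm_real, Real.norm_eq_abs, abs_le]
          exact ⟨by linarith [x.1.2.1], x.1.2.2⟩
        have h2 : ‖((x.2.1 : U) : ℂ) - z0‖ < r := by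
          rw [← dist_eq_norm]; exact x.2.1.2
        calc _ ≤ 1 * ‖((x.2.1 : U) : ℂ) - z0‖ := by gcongr
          _ < r := by rwa [one_mul])⟩
    have hmc : Continuous m := Continuous.subtype_mk (by fun_prop) _
    obtain ⟨L, hL, hLe⟩ := aux_log_homotopy (A := S × U) (fun x => Q (m x) x.2.2)
      (hQc hmc (by fun_prop)) (fun x => hQ0 _ _) (fun a => l z0 a.2)
      ((hlc z0).comp continuous_snd) (by
        intro a
        have : m (0, a) = z0 := Subtype.ext (by simp [m])
        rw [hle, this])
    have hLe' : ∀ a : S × U, Complex.exp (L a) = Q a.1 a.2 := fun a => by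
      have : m (1, a) = a.1 := Subtype.ext (by simp [m])
      rw [hLe, this]
    have hkey : ∀ z : S, l z = fun w => L (z, w) - L (z, p) := by
      intro z
      refine aux_exp_unique (hlc z) (by fun_prop) (fun w => ?_) p (by simp [hlp])
      rw [Complex.exp_sub, hLe', hLe', hle, hQp, div_one]
    have hco : ContinuousOn (fun z : U => l z z) S := by
      rw [continuousOn_iff_continuous_domRestrict]
      have : S.domRestrict (fun z : U => l z z) = fun z : S => L (z, z) - L (z, p) := by
        funext z
        change l z z = _
        rw [hkey z]
      rw [this]
      fun_prop
    exact hco.continuousAt (hSo.mem_nhds (by simp [S, hr]))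
  exact ⟨_, hdiag, fun z => hle z z⟩

lemma aux_sqrt {F : ℂ → ℂ} {U : Set ℂ} (hU : IsOpen U) (hUc : IsConnected U)
    (hF : DifferentiableOn ℂ F U) (hinj : InjOn F U) :
    ∃ h : ℂ → ℂ, ContinuousOn h U ∧ ∀ z ∈ U, h z ^ 2 = deriv F z := by
  obtain ⟨p⟩ : Nonempty U := hUc.nonempty.to_subtype
  have : PathConnectedSpace U :=
    isPathConnected_iff_pathConnectedSpace.1 (hU.isConnected_iff_isPathConnected.1 hUc)
  have hGc := auxG_cont hU hF
  have hG0 : ∀ z w : U, auxG F z w ≠ 0 := fun z w => auxG_ne_zero hU hF hinj z.2 w.2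
  have hGc' : ∀ {A : Type} [TopologicalSpace A] {f g : A → U}, Continuous f → Continuous g →
      Continuous fun a => auxG F (f a) (g a) := by
    intro A _ f g hf hg
    exact Continuous.comp (g := fun x : U × U => auxG F x.1 x.2) (f := fun a => (f a, g a))
      hGc (hf.prodMk hg)
  have hG0' : ∀ z w : ℂ, z ∈ U → w ∈ U → auxG F z w ≠ 0 := fun z w hz hw => hG0 ⟨z, hz⟩ ⟨w, hw⟩
  obtain ⟨l, hdiag, hle⟩ : ∃ l : U → ℂ, Continuous l ∧
      ∀ z : U, Complex.exp (l z) = auxG F z z * auxG F p p / (auxG F z p * auxG F p z) := by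
    refine aux_diag_log hU p
      (fun z w : U => auxG F (z : ℂ) (w : ℂ) * auxG F p p / (auxG F z p * auxG F p w)) ?_ ?_ ?_ ?_
    · exact (hGc.mul continuous_const).div
        ((hGc' continuous_fst continuous_const).mul (hGc' continuous_const continuous_snd))
        (fun a => mul_ne_zero (hG0 _ _) (hG0 _ _))
    · intro z w
      exact div_ne_zero (mul_ne_zero (hG0 _ _) (hG0 _ _)) (mul_ne_zero (hG0 _ _) (hG0 _ _))
    · intro z
      exact div_self (mul_ne_zero (hG0 _ _) (hG0 _ _))
    · intro w
      rw [mul_comm]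
      exact div_self (mul_ne_zero (hG0 _ _) (hG0 _ _))
  obtain ⟨c, hc⟩ : ∃ c : ℂ, c ^ 2 = (auxG F p p)⁻¹ := IsAlgClosed.exists_pow_nat_eq _ two_pos
  classical
  refine ⟨fun z => if hz : z ∈ U then
    auxG F z p * c * Complex.exp (l ⟨z, hz⟩ / 2) else 0, ?_, ?_⟩
  · rw [continuousOn_iff_continuous_domRestrict]
    have : (U.domRestrict fun z => if hz : z ∈ U then
        auxG F z p * c * Complex.exp (l ⟨z, hz⟩ / 2) else 0) =
        fun z : U => auxG F z p * c * Complex.exp (l z / 2) := by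
      funext z
      simp
    rw [this]
    have h1 : Continuous fun z : U => auxG F z p := hGc' continuous_id continuous_const
    fun_prop
  · intro z hz
    have hle' := hle ⟨z, hz⟩
    simp only [hz, dif_pos]
    rw [mul_pow, mul_pow, ← Complex.exp_nat_mul]
    have : ((2 : ℕ) : ℂ) * (l ⟨z, hz⟩ / 2) = l ⟨z, hz⟩ := by push_cast; ring
    rw [this, hle', hc]
    have h1 := hG0 ⟨z, hz⟩ p
    have h2 := hG0 p p
    rw [auxG_symm F p z, auxG_self F z]
    generalize auxG F p p = x at *
    generalize deriv F z = y at *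
    change auxG F z p ≠ 0 at h1
    generalize auxG F z p = u at *
    field_simp

lemma aux_sqrt_diff {f h : ℂ → ℂ} {U : Set ℂ} (hU : IsOpen U) (hf : DifferentiableOn ℂ f U)
    (hf0 : ∀ z ∈ U, f z ≠ 0) (hh : ContinuousOn h U) (hsq : ∀ z ∈ U, h z ^ 2 = f z) :
    DifferentiableOn ℂ h U := by
  intro a ha
  apply DifferentiableAt.differentiableWithinAt
  have hUa := hU.mem_nhds ha
  have hha : h a ≠ 0 := fun e => hf0 a ha (by rw [← hsq a ha, e]; simp)
  have hca : ContinuousAt h a := hh.continuousAt hUa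
  have hfd := (hf.differentiableAt hUa).hasDerivAt
  have : HasDerivAt h (deriv f a / (h a + h a)) a := by
    rw [hasDerivAt_iff_tendsto_slope] at hfd ⊢
    have hsum : Tendsto (fun z => h z + h a) (𝓝[≠] a) (𝓝 (h a + h a)) :=
      (hca.tendsto.mono_left nhdsWithin_le_nhds).add_const _
    have hsne : h a + h a ≠ 0 := by rw [← two_mul]; exact mul_ne_zero two_ne_zero hha
    refine (hfd.div hsum hsne).congr' ?_
    filter_upwards [mem_nhdsWithin_of_mem_nhds hUa, hsum.eventually_ne hsne,
      eventually_mem_nhdsWithin] with z hz hz2 hz3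
    have hz4 : z - a ≠ 0 := sub_ne_zero.2 hz3
    simp only [slope_def_field, Pi.div_apply]
    rw [← hsq z hz, ← hsq a ha]
    field_simp
    ring
  exact this.differentiableAt


lemma aux_local {Ω : Set ℂ} (hΩ : IsOpen Ω) {γ : ℝ → ℂ} {t0 : ℝ} (hγ : AnalyticAt ℝ γ t0)
    (hc : deriv γ t0 ≠ 0)
    (hloc : ∀ δ > 0, ∀ᶠ z in 𝓝 (γ t0), z ∈ frontier Ω → ∃ s : ℝ, |s| < δ ∧ γ (t0 + s) = z)
    (hcl : γ t0 ∉ interior (closure Ω)) :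
    ∀ V ∈ 𝓝 (γ t0), ∃ W ∈ 𝓝 (γ t0), W ⊆ V ∧ IsPreconnected (W ∩ Ω) := by
  intro V hV
  set c := deriv γ t0 with hcdef
  let e : ℂ ≃L[ℝ] ℂ := ContinuousLinearEquiv.smulLeft (Units.mk0 c hc)
  set Φ : ℂ → ℂ := fun x => γ (t0 + x.re) + x.im • (I * c) with hΦ
  have hΦ0 : Φ 0 = γ t0 := by simp [hΦ]
  have hstr : HasStrictFDerivAt Φ (e : ℂ →L[ℝ] ℂ) 0 := by
    have h1 : HasStrictDerivAt γ c (t0 + (0 : ℂ).re) := by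
      simpa using hγ.hasStrictDerivAt
    have h2 : HasStrictFDerivAt (fun x : ℂ => t0 + x.re) Complex.reCLM 0 :=
      Complex.reCLM.hasStrictFDerivAt.const_add t0
    have h3 := h1.hasStrictFDerivAt.comp (0 : ℂ) h2
    have h4 : HasStrictFDerivAt (fun x : ℂ => x.im • (I * c))
        (Complex.imCLM.smulRight (I * c)) 0 :=
      (Complex.imCLM.smulRight (I * c)).hasStrictFDerivAt
    have h5 := h3.add h4
    refine h5.congr_fderiv ?_
    ext x
    simp only [e, add_apply, ContinuousLinearMap.comp_apply,
      ContinuousLinearMap.smulRight_apply, ContinuousLinearMap.toSpanSingleton_apply,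
      Complex.reCLM_apply, Complex.imCLM_apply, Complex.real_smul,
      ContinuousLinearEquiv.coe_coe, ContinuousLinearEquiv.smulLeft_apply_apply,
      Units.smul_def, Units.val_mk0, smul_eq_mul]
    conv_rhs => rw [← Complex.re_add_im x]
    ring
  let E := hstr.toOpenPartialHomeomorph Φ
  have hE : ∀ x, E x = Φ x := fun x => rfl
  have h0E : (0 : ℂ) ∈ E.source := hstr.mem_toOpenPartialHomeomorph_source
  obtain ⟨δ, hδ, hδs⟩ := Metric.isOpen_iff.1 E.open_source 0 h0E
  have hcontΦ : ContinuousOn Φ E.source := E.continuousOn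
  have hev : ∀ᶠ x in 𝓝 (0 : ℂ), Φ x ∈ V ∧
      (Φ x ∈ frontier Ω → ∃ s : ℝ, |s| < δ ∧ γ (t0 + s) = Φ x) := by
    have hca : ContinuousAt Φ 0 := hcontΦ.continuousAt (E.open_source.mem_nhds h0E)
    have := hca.tendsto
    rw [hΦ0] at this
    exact this.eventually ((eventually_mem_set.2 hV).and (hloc δ hδ))
  obtain ⟨ρ, hρ, hρs⟩ := Metric.eventually_nhds_iff_ball.1 hev
  set r := min ρ δ with hr
  have hr0 : 0 < r := lt_min hρ hδ
  have hbs : ball (0 : ℂ) r ⊆ E.source := (ball_subset_ball (min_le_right _ _)).trans hδs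
  have hreal : ∀ x ∈ ball (0 : ℂ) r, Φ x ∈ frontier Ω → x.im = 0 := by
    intro x hx hxf
    obtain ⟨s, hs, hse⟩ := (hρs x (ball_subset_ball (min_le_left _ _) hx)).2 hxf
    have hss : (s : ℂ) ∈ E.source := hδs (by simpa using hs)
    have : (s : ℂ) = x := by
      apply E.injOn hss (hbs hx)
      rw [hE, hE, ← hse]
      simp [hΦ]
    rw [← this]; simp
  set W := Φ '' ball (0 : ℂ) r with hW
  have hWo : IsOpen W := E.isOpen_image_of_subset_source isOpen_ball hbs
  have hWm : W ∈ 𝓝 (γ t0) := hWo.mem_nhds ⟨0, mem_ball_self hr0, hΦ0⟩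
  -- the two sides
  have hside : ∀ C : Set ℂ, Convex ℝ C → (∀ x ∈ C, x.im ≠ 0) →
      IsPreconnected (Φ '' (ball 0 r ∩ C)) ∧
      (Φ '' (ball 0 r ∩ C) ⊆ Ω ∨ Disjoint (Φ '' (ball 0 r ∩ C)) Ω) := by
    intro C hC hCi
    have hp : IsPreconnected (Φ '' (ball 0 r ∩ C)) :=
      ((convex_ball (0 : ℂ) r).inter hC).isPreconnected.image _
        (hcontΦ.mono (inter_subset_left.trans hbs))
    refine ⟨hp, ?_⟩
    by_contra hcon
    push Not at hcon
    obtain ⟨h1, h2⟩ := hcon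
    obtain ⟨a, haP, haΩ⟩ := not_subset.1 h1
    obtain ⟨b, hbP, hbΩ⟩ := not_disjoint_iff.1 h2
    have hnf : ∀ y ∈ Φ '' (ball 0 r ∩ C), y ∉ frontier Ω := by
      rintro y ⟨x, ⟨hxb, hxC⟩, rfl⟩ hyf
      exact hCi x hxC (hreal x hxb hyf)
    have hincl : Φ '' (ball 0 r ∩ C) ⊆ Ω ∪ (closure Ω)ᶜ := by
      intro y hy
      by_cases hyc : y ∈ closure Ω
      · left
        by_contra hyn
        exact hnf y hy (by rw [hΩ.frontier_eq]; exact ⟨hyc, hyn⟩)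
      · exact Or.inr hyc
    obtain ⟨y, -, hy1, hy2⟩ := hp Ω (closure Ω)ᶜ hΩ isClosed_closure.isOpen_compl hincl
      ⟨b, hbP, hbΩ⟩ ⟨a, haP, (hincl haP).resolve_left haΩ⟩
    exact hy2 (subset_closure hy1)
  let C : ℝ → Set ℂ := fun σ => {x | 0 < σ * x.im}
  have hCconv : ∀ σ, Convex ℝ (C σ) := by
    intro σ
    exact convex_halfSpace_gt (f := fun x : ℂ => σ * x.im)
      (IsLinearMap.mk (by intro x y; simp; ring) (by intro a x; simp; ring)) 0
  have hCim : ∀ σ, ∀ x ∈ C σ, x.im ≠ 0 := by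
    intro σ x hx h0
    simp [C, h0] at hx
  have hclos : ∀ σ : ℝ, σ ≠ 0 → ∀ x ∈ ball (0 : ℂ) r, x.im = 0 →
      Φ x ∈ closure (Φ '' (ball 0 r ∩ C σ)) := by
    intro σ hσ x hx hx0
    have hcx : ContinuousAt Φ x := hcontΦ.continuousAt (E.open_source.mem_nhds (hbs hx))
    have ht : Tendsto (fun t : ℝ => x + (t * σ : ℝ) * I) (𝓝[>] 0) (𝓝 x) := by
      have : Continuous fun t : ℝ => x + (t * σ : ℝ) * I := by fun_prop
      have h := this.tendsto 0
      simp only [zero_mul, Complex.ofReal_zero, add_zero] at h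
      exact h.mono_left nhdsWithin_le_nhds
    refine mem_closure_of_tendsto (hcx.tendsto.comp ht) ?_
    filter_upwards [ht.eventually (isOpen_ball.mem_nhds hx), eventually_mem_nhdsWithin]
      with t ht1 ht2
    refine ⟨_, ⟨ht1, ?_⟩, rfl⟩
    have h1 : 0 < t := ht2
    have h2 : 0 < σ * σ := mul_self_pos.2 hσ
    have h3 : (x + (t * σ : ℝ) * I).im = t * σ := by simp [hx0]
    change 0 < σ * _
    rw [h3]
    nlinarith [mul_pos h1 h2]
  have hWsub : ∀ z ∈ W, (z ∈ Φ '' (ball 0 r ∩ C 1)) ∨ (z ∈ Φ '' (ball 0 r ∩ C (-1))) ∨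
      ∃ x ∈ ball (0 : ℂ) r, x.im = 0 ∧ Φ x = z := by
    rintro z ⟨x, hx, rfl⟩
    rcases lt_trichotomy x.im 0 with h | h | h
    · exact Or.inr (Or.inl ⟨x, ⟨hx, by simpa [C] using h⟩, rfl⟩)
    · exact Or.inr (Or.inr ⟨x, hx, h, rfl⟩)
    · exact Or.inl ⟨x, ⟨hx, by simpa [C] using h⟩, rfl⟩
  obtain ⟨hp1, hs1⟩ := hside (C 1) (hCconv 1) (hCim 1)
  obtain ⟨hp2, hs2⟩ := hside (C (-1)) (hCconv (-1)) (hCim (-1))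
  have hnot : ¬ (Φ '' (ball 0 r ∩ C 1) ⊆ Ω ∧ Φ '' (ball 0 r ∩ C (-1)) ⊆ Ω) := by
    rintro ⟨h1, h2⟩
    apply hcl
    refine mem_interior.2 ⟨W, ?_, hWo, mem_of_mem_nhds hWm⟩
    intro z hz
    rcases hWsub z hz with h | h | ⟨x, hx, hx0, rfl⟩
    · exact subset_closure (h1 h)
    · exact subset_closure (h2 h)
    · exact closure_mono h1 (hclos 1 one_ne_zero x hx hx0)
  have hrealΩ : ∀ x ∈ ball (0 : ℂ) r, x.im = 0 → Φ x ∉ Ω := by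
    intro x hx hx0 hxΩ
    apply hnot
    have key : ∀ σ : ℝ, σ ≠ 0 → ¬ Disjoint (Φ '' (ball 0 r ∩ C σ)) Ω := by
      intro σ hσ hd
      obtain ⟨y, hy1, hy2⟩ := mem_closure_iff.1 (hclos σ hσ x hx hx0) Ω hΩ hxΩ
      exact disjoint_left.1 hd hy2 hy1
    exact ⟨hs1.resolve_right (key 1 (by norm_num)), hs2.resolve_right (key (-1) (by norm_num))⟩
  have hWV : W ⊆ V := by
    rintro z ⟨x, hx, rfl⟩
    exact (hρs x (ball_subset_ball (min_le_left _ _) hx)).1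
  refine ⟨W, hWm, hWV, ?_⟩
  have hsubW : ∀ σ, Φ '' (ball 0 r ∩ C σ) ⊆ W := fun σ => image_mono inter_subset_left
  rcases hs1 with h1 | h1
  · have h2 := hs2.resolve_left (fun h => hnot ⟨h1, h⟩)
    have : W ∩ Ω = Φ '' (ball 0 r ∩ C 1) := by
      refine Subset.antisymm ?_ (subset_inter (hsubW 1) h1)
      rintro z ⟨hzW, hzΩ⟩
      rcases hWsub z hzW with h | h | ⟨x, hx, hx0, rfl⟩
      · exact h
      · exact absurd hzΩ (disjoint_left.1 h2 h)
      · exact absurd hzΩ (hrealΩ x hx hx0)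
    rw [this]; exact hp1
  · rcases hs2 with h2 | h2
    · have : W ∩ Ω = Φ '' (ball 0 r ∩ C (-1)) := by
        refine Subset.antisymm ?_ (subset_inter (hsubW (-1)) h2)
        rintro z ⟨hzW, hzΩ⟩
        rcases hWsub z hzW with h | h | ⟨x, hx, hx0, rfl⟩
        · exact absurd hzΩ (disjoint_left.1 h1 h)
        · exact h
        · exact absurd hzΩ (hrealΩ x hx hx0)
      rw [this]; exact hp2
    · have : W ∩ Ω = ∅ := by
        rw [eq_empty_iff_forall_notMem]
        rintro z ⟨hzW, hzΩ⟩
        rcases hWsub z hzW with h | h | ⟨x, hx, hx0, rfl⟩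
        · exact disjoint_left.1 h1 h hzΩ
        · exact disjoint_left.1 h2 h hzΩ
        · exact hrealΩ x hx hx0 hzΩ
      rw [this]; exact isPreconnected_empty


lemma aux_curve_loc {Ω : Set ℂ} (B : PABoundary Ω) (i : Fin B.n) (t0 : ℝ) (δ : ℝ) (hδ : 0 < δ) :
    ∀ᶠ z in 𝓝 (B.curve i t0), z ∈ frontier Ω → ∃ s : ℝ, |s| < δ ∧ B.curve i (t0 + s) = z := by
  have h1 : ∀ᶠ z in 𝓝 (B.curve i t0), ∀ j, j ≠ i → z ∉ range (B.curve j) := by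
    rw [eventually_all]
    intro j
    by_cases hj : j = i
    · simp [hj]
    · have hc : IsCompact (range (B.curve j)) :=
        (B.periodic j).compact_of_continuous one_ne_zero (B.cont j)
      have hn : B.curve i t0 ∉ range (B.curve j) := fun h =>
        disjoint_left.1 (B.disjointCurves j i hj) h (mem_range_self _)
      filter_upwards [hc.isClosed.isOpen_compl.mem_nhds hn] with z hz _ using hz
  have h2 : ∀ᶠ z in 𝓝 (B.curve i t0), z ∉ B.curve i '' Icc (t0 + δ) (t0 + 1 - δ) := by
    have hc : IsCompact (B.curve i '' Icc (t0 + δ) (t0 + 1 - δ)) :=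
      isCompact_Icc.image (B.cont i)
    refine hc.isClosed.isOpen_compl.mem_nhds ?_
    rintro ⟨t, ht, hte⟩
    have hfr : ∀ x, B.curve i (Int.fract x) = B.curve i x := by
      intro x
      have := (B.periodic i).sub_int_mul_eq (x := x) ⌊x⌋
      rwa [mul_one] at this
    have hf : Int.fract t = Int.fract t0 := by
      apply B.injOn i ⟨Int.fract_nonneg _, Int.fract_lt_one _⟩
        ⟨Int.fract_nonneg _, Int.fract_lt_one _⟩
      rw [hfr, hfr, hte]
    obtain ⟨n, hn⟩ := Int.fract_eq_fract.1 hf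
    have h3 : (0 : ℝ) < n := by rw [← hn]; linarith [ht.1]
    have h4 : (n : ℝ) < 1 := by rw [← hn]; linarith [ht.2]
    have h5 : 0 < n := by exact_mod_cast h3
    have h6 : n < 1 := by exact_mod_cast h4
    omega
  filter_upwards [h1, h2] with z h1 h2 hz
  rw [← B.boundary, mem_iUnion] at hz
  obtain ⟨j, hj⟩ := hz
  have hji : j = i := by
    by_contra hne
    exact h1 j hne hj
  subst hji
  obtain ⟨t, rfl⟩ := hj
  obtain ⟨t', ht', hte⟩ := (B.periodic j).exists_mem_Ico one_pos t t0
  rw [hte] at h2 ⊢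
  by_cases ha : t' < t0 + δ
  · refine ⟨t' - t0, ?_, by congr 1; ring⟩
    rw [abs_lt]
    exact ⟨by linarith [ht'.1], by linarith⟩
  · have hb : t0 + 1 - δ < t' := by
      by_contra hb
      exact h2 ⟨t', ⟨not_lt.1 ha, not_lt.1 hb⟩, rfl⟩
    refine ⟨t' - t0 - 1, ?_, ?_⟩
    · rw [abs_lt]
      exact ⟨by linarith, by linarith [ht'.2]⟩
    · rw [← B.periodic j]; congr 1; ring

lemma aux_inj {Ω U : Set ℂ} {F : ℂ → ℂ} (hΩ : IsOpen Ω) (hU : IsOpen U) (hΩU : Ω ⊆ U)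
    (hUc : U ⊆ closure Ω) (hF : ∀ z ∈ U, AnalyticAt ℂ F z) (hd : ∀ z ∈ U, deriv F z ≠ 0)
    (hinj : InjOn F Ω) : InjOn F U := by
  intro a ha b hb hab
  by_contra hne
  have hmap : ∀ z ∈ U, map F (𝓝 z) = 𝓝 (F z) := fun z hz =>
    (hF z hz).hasStrictDerivAt.map_nhds_eq (hd z hz)
  obtain ⟨Na, Nb, hNa, hNb, haN, hbN, hdis⟩ := t2_separation hne
  have h1 : F '' (Nb ∩ U) ∈ 𝓝 (F a) := by
    rw [hab, ← hmap b hb]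
    exact image_mem_map ((hNb.inter hU).mem_nhds ⟨hbN, hb⟩)
  have h2 : F ⁻¹' (F '' (Nb ∩ U)) ∩ Na ∈ 𝓝 a :=
    inter_mem ((hF a ha).continuousAt h1) (hNa.mem_nhds haN)
  obtain ⟨a', ⟨⟨b', ⟨hb'N, hb'U⟩, hb'⟩, ha'N⟩, ha'Ω⟩ :=
    mem_closure_iff_nhds.1 (hUc ha) _ h2
  have h3 : F '' (Na ∩ Ω) ∈ 𝓝 (F b') := by
    rw [hb', ← hmap a' (hΩU ha'Ω)]
    exact image_mem_map ((hNa.inter hΩ).mem_nhds ⟨ha'N, ha'Ω⟩)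
  have h4 : F ⁻¹' (F '' (Na ∩ Ω)) ∩ Nb ∈ 𝓝 b' :=
    inter_mem ((hF b' hb'U).continuousAt h3) (hNb.mem_nhds hb'N)
  obtain ⟨b'', ⟨⟨a'', ⟨ha''N, ha''Ω⟩, ha''⟩, hb''N⟩, hb''Ω⟩ :=
    mem_closure_iff_nhds.1 (hUc hb'U) _ h4
  have := hinj ha''Ω hb''Ω ha''
  subst this
  exact disjoint_left.1 hdis ha''N hb''N


/-- The core statement, for a connected open set `Ω` with piecewise-analytic boundary. -/
lemma aux_main {Ω : Set ℂ} (hΩ : IsOpen Ω) (hconn : IsConnected Ω) (B : PABoundary Ω)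
    (F : ℂ → ℂ) (hF : DifferentiableOn ℂ F Ω) (hFinj : Set.InjOn F Ω)
    (hFarc : ∀ z ∈ frontier Ω \ (B.corners : Set ℂ), AnalyticAt ℂ F z) :
    ∃ h : ℂ → ℂ, DifferentiableOn ℂ h Ω ∧
      ContinuousOn h (closure Ω \ (B.corners : Set ℂ)) ∧
      ∀ z ∈ closure Ω \ (B.corners : Set ℂ), h z ^ 2 = deriv F z := by
  have hcor : ∀ z ∈ Ω, z ∉ (B.corners : Set ℂ) := by
    intro z hz hzc
    have := B.cornersOnBoundary hzc
    rw [hΩ.frontier_eq] at this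
    exact this.2 hz
  have hAn : ∀ z ∈ closure Ω \ (B.corners : Set ℂ), AnalyticAt ℂ F z := by
    rintro z ⟨hz, hzc⟩
    by_cases hzΩ : z ∈ Ω
    · exact hF.analyticAt (hΩ.mem_nhds hzΩ)
    · exact hFarc z ⟨by rw [hΩ.frontier_eq]; exact ⟨hz, hzΩ⟩, hzc⟩
  have hd0 : ∀ z ∈ Ω, deriv F z ≠ 0 := fun z hz => aux_deriv_ne_zero hΩ hF hFinj hz
  set O : Set ℂ := interior (closure Ω) \ (B.corners : Set ℂ) with hO
  have hOo : IsOpen O := isOpen_interior.sdiff B.corners.finite_toSet.isClosed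
  have hOA : O ⊆ closure Ω \ (B.corners : Set ℂ) := sdiff_subset_sdiff_left interior_subset
  have hΩO : Ω ⊆ O := fun z hz => ⟨interior_maximal subset_closure hΩ hz, hcor z hz⟩
  set U : Set ℂ := O ∩ {z | deriv F z ≠ 0} with hUdef
  have hUo : IsOpen U := by
    have hc : ContinuousOn (deriv F) O := fun z hz =>
      (hAn z (hOA hz)).deriv.continuousAt.continuousWithinAt
    exact hc.isOpen_inter_preimage hOo isOpen_ne
  have hΩU : Ω ⊆ U := fun z hz => ⟨hΩO hz, hd0 z hz⟩
  have hUA : U ⊆ closure Ω \ (B.corners : Set ℂ) := inter_subset_left.trans hOA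
  have hUcl : U ⊆ closure Ω := fun z hz => (hUA hz).1
  have hUc : IsConnected U := hconn.subset_closure hΩU hUcl
  have hFU : ∀ z ∈ U, AnalyticAt ℂ F z := fun z hz => hAn z (hUA hz)
  have hinjU : InjOn F U := aux_inj hΩ hUo hΩU hUcl hFU (fun z hz => hz.2) hFinj
  obtain ⟨h0, h0c, h0sq⟩ := aux_sqrt hUo hUc
    (fun z hz => (hFU z hz).differentiableAt.differentiableWithinAt) hinjU
  have h0d : DifferentiableOn ℂ h0 U := aux_sqrt_diff hUo
    (fun z hz => (hFU z hz).deriv.differentiableAt.differentiableWithinAt)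
    (fun z hz => hz.2) h0c h0sq
  have hdc : ∀ x ∈ closure Ω \ (B.corners : Set ℂ), ContinuousAt (deriv F) x := fun x hx =>
    (hAn x hx).deriv.continuousAt
  have hlim : ∀ x ∈ closure Ω \ (B.corners : Set ℂ), ∃ y, Tendsto h0 (𝓝[Ω] x) (𝓝 y) := by
    intro x hx
    by_cases hxU : x ∈ U
    · exact ⟨h0 x, (h0c x hxU).tendsto.mono_left (nhdsWithin_mono x hΩU)⟩
    by_cases hx0 : deriv F x = 0
    · refine ⟨0, ?_⟩
      have h1 : Tendsto (fun z => Real.sqrt ‖deriv F z‖) (𝓝[Ω] x) (𝓝 0) := by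
        have h2 : Tendsto (deriv F) (𝓝[Ω] x) (𝓝 (deriv F x)) :=
          (hdc x hx).tendsto.mono_left nhdsWithin_le_nhds
        have h3 := (Real.continuous_sqrt.tendsto _).comp h2.norm
        simpa [hx0, Function.comp_def] using h3
      rw [tendsto_zero_iff_norm_tendsto_zero]
      refine h1.congr' ?_
      filter_upwards [self_mem_nhdsWithin] with z hz
      rw [← h0sq z (hΩU hz), norm_pow, Real.sqrt_sq (norm_nonneg _)]
    · have hxi : x ∉ interior (closure Ω) := fun h => hxU ⟨⟨h, hx.2⟩, hx0⟩
      have hxΩ : x ∉ Ω := fun h => hxU (hΩU h)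
      have hxf : x ∈ frontier Ω := by rw [hΩ.frontier_eq]; exact ⟨hx.1, hxΩ⟩
      have hxf' := hxf
      rw [← B.boundary, mem_iUnion] at hxf'
      obtain ⟨i, t0, rfl⟩ := hxf'
      obtain ⟨hγ, hγ'⟩ := B.analyticArc i t0 hx.2
      obtain ⟨d, hd⟩ : ∃ d : ℂ, d ^ 2 = deriv F (B.curve i t0) :=
        IsAlgClosed.exists_pow_nat_eq _ two_pos
      set x := B.curve i t0 with hxdef
      set q : ℂ → ℂ := fun z => d * Complex.exp (Complex.log (deriv F z / deriv F x) / 2) with hq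
      have hdne : d ≠ 0 := by
        rintro rfl
        exact hx0 (by rw [← hd]; simp)
      have hV : {z | AnalyticAt ℂ F z ∧ deriv F z ≠ 0 ∧ deriv F z / deriv F x ∈ slitPlane}
          ∈ 𝓝 x := by
        have h1 : ContinuousAt (fun z => deriv F z / deriv F x) x := (hdc x hx).div_const _
        have h2 : deriv F x / deriv F x ∈ slitPlane := by rw [div_self hx0]; simp
        filter_upwards [(hAn x hx).eventually_analyticAt, (hdc x hx).eventually_ne hx0,
          h1 (isOpen_slitPlane.mem_nhds h2)] with z a b c using ⟨a, b, c⟩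
      have hqc : ∀ z, AnalyticAt ℂ F z → deriv F z / deriv F x ∈ slitPlane →
          ContinuousAt q z := by
        intro z hz1 hz2
        have h1 : ContinuousAt (fun z => deriv F z / deriv F x) z :=
          hz1.deriv.continuousAt.div_const _
        exact continuousAt_const.mul ((h1.clog hz2).div_const _).cexp
      have hq0 : ∀ z, q z ≠ 0 := fun z => mul_ne_zero hdne (Complex.exp_ne_zero _)
      obtain ⟨W, hWx, hWV, hWc⟩ := aux_local hΩ hγ hγ'
        (fun δ hδ => aux_curve_loc B i t0 δ hδ) hxi _ hV
      have hqs : EqOn (h0 ^ 2) (q ^ 2) (W ∩ Ω) := by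
        rintro z ⟨hzW, hzΩ⟩
        simp only [Pi.pow_apply, hq]
        rw [h0sq z (hΩU hzΩ), mul_pow, ← Complex.exp_nat_mul, hd]
        have : ((2 : ℕ) : ℂ) * (Complex.log (deriv F z / deriv F x) / 2) =
            Complex.log (deriv F z / deriv F x) := by push_cast; ring
        rw [this, Complex.exp_log (div_ne_zero (hWV hzW).2.1 hx0), mul_div_cancel₀ _ hx0]
      have hqx : Tendsto q (𝓝[Ω] x) (𝓝 (q x)) :=
        (hqc x (hAn x hx) (by rw [div_self hx0]; simp)).tendsto.mono_left nhdsWithin_le_nhds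
      have hWm : W ∩ Ω ∈ 𝓝[Ω] x :=
        inter_mem (mem_nhdsWithin_of_mem_nhds hWx) self_mem_nhdsWithin
      rcases hWc.eq_or_eq_neg_of_sq_eq (h0c.mono (inter_subset_right.trans hΩU))
        (fun z hz => (hqc z (hWV hz.1).1 (hWV hz.1).2.2).continuousWithinAt) hqs
        (fun _ => hq0 _) with h | h
      · exact ⟨q x, hqx.congr' (by filter_upwards [hWm] with z hz using (h hz).symm)⟩
      · exact ⟨-q x, hqx.neg.congr' (by filter_upwards [hWm] with z hz using (h hz).symm)⟩
  have hext : ∀ z ∈ Ω, extendFrom Ω h0 z = h0 z := extendFrom_extends (h0c.mono hΩU)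
  refine ⟨extendFrom Ω h0, (h0d.mono hΩU).congr hext,
    continuousOn_extendFrom sdiff_subset hlim, ?_⟩
  intro x hx
  have : (𝓝[Ω] x).NeBot := mem_closure_iff_nhdsWithin_neBot.1 hx.1
  have h1 := (tendsto_extendFrom (hlim x hx)).pow 2
  have h2 : Tendsto (deriv F) (𝓝[Ω] x) (𝓝 (deriv F x)) :=
    (hdc x hx).tendsto.mono_left nhdsWithin_le_nhds
  refine tendsto_nhds_unique h1 (h2.congr' ?_)
  filter_upwards [self_mem_nhdsWithin] with z hz
  exact (h0sq z (hΩU hz)).symm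

/-- Let `Ω = ℂ∞ ∖ K` be a finitely connected domain containing `∞` with
piecewise-analytic boundary and corner set `E`, let `Ω̃ = ℂ∞ ∖ K̃` be a finitely connected
domain with analytic boundary, and let `F : Ω → Ω̃` be a conformal map with `F(∞) = ∞`
(extended continuously to `Ω̄` and analytically across each open analytic arc of `∂Ω`).
Then `F′` has an analytic square root: there is `h` holomorphic in `Ω` and continuous on
`Ω̄ ∖ E` with `h(z)² = F′(z)` for all `z ∈ Ω̄ ∖ E`. -/
theorem deriv_conformal_has_sqrt (K Kt : Set ℂ) (hK : IsCompact K) (hKt : IsCompact Kt)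
    (hconn : IsConnected Kᶜ) (hconnt : IsConnected Ktᶜ)
    (B : PABoundary Kᶜ) (Bt : AnalyticBoundary Ktᶜ)
    (F : ℂ → ℂ)
    (hF : DifferentiableOn ℂ F Kᶜ) (hFbij : Set.BijOn F Kᶜ Ktᶜ)
    (hFinf : Tendsto F (cobounded ℂ ⊓ 𝓟 Kᶜ) (cobounded ℂ))
    (hFext : ContinuousOn F (interior K)ᶜ)
    (hFarc : ∀ z ∈ frontier K \ (B.corners : Set ℂ), AnalyticAt ℂ F z) :
    ∃ h : ℂ → ℂ, DifferentiableOn ℂ h Kᶜ ∧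
      ContinuousOn h ((interior K)ᶜ \ (B.corners : Set ℂ)) ∧
      ∀ z ∈ (interior K)ᶜ \ (B.corners : Set ℂ), h z ^ 2 = deriv F z := by
  rw [← closure_compl]
  rw [← frontier_compl] at hFarc
  exact aux_main hK.isClosed.isOpen_compl hconn B F hF hFbij.injOn hFarc
end
end
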